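/- Let K=K(c_1,c_2,c_2,c_1) be a symmetric A_4-crystal with symmetric extract C=(S, E_{1bar} disjoint-union E_{2bar}). Then C is isomorphic, as a 2-colored graph with color 1bar corresponding to 2tilde and color 2bar corresponding to 1tilde, to the worm graph W(c_2,c_1). -/

import Mathlib

open Classical

noncomputable section

/-- Iterate a partial operator `k` times. -/
def optIter {V : Type} (f : V → Option V) : ℕ → V → Option V
  | 0, v => some v
  | k + 1, v => (f v).bind (optIter f k)

/-- A vertex type together with, for every natural number (color) `i`,
a partial operator whose graph is the set of `i`-edges. -/
structure PreGraph where
  V : Type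
  F : ℕ → V → Option V

namespace PreGraph

/-- Partial inverse operator of color `i`. -/
def Finv (K : PreGraph) (i : ℕ) (v : K.V) : Option K.V :=
  if h : ∃ u, K.F i u = some v then some h.choose else none

/-- Number of edges of the maximal `i`-colored path beginning at `v`. -/
def h (K : PreGraph) (i : ℕ) (v : K.V) : ℕ :=
  sSup {k | (optIter (K.F i) k v).isSome = true}

/-- Number of edges of the maximal `i`-colored path ending at `v`. -/
def t (K : PreGraph) (i : ℕ) (v : K.V) : ℕ :=
  sSup {k | ∃ u, optIter (K.F i) k u = some v}

/-- One (undirected) step along an edge of any color. -/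
def Step (K : PreGraph) (u v : K.V) : Prop :=
  ∃ i, K.F i u = some v ∨ K.F i v = some u

/-- Weak connectivity. -/
def Connected (K : PreGraph) : Prop :=
  ∀ u v : K.V, Relation.ReflTransGen K.Step u v

/-- All edges have colors in `C`. -/
def ColorsIn (K : PreGraph) (C : Set ℕ) : Prop :=
  ∀ i ∉ C, ∀ v, K.F i v = none

end PreGraph

/-- `s` has no incoming edges. -/
def IsSource (K : PreGraph) (s : K.V) : Prop := ∀ i u, K.F i u ≠ some s

/-- `tv` has no outgoing edges. -/
def IsSink (K : PreGraph) (tv : K.V) : Prop := ∀ i, K.F i tv = none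

/-- `K` is a (finite) colored graph with colors in `C` satisfying axiom (A1):
every connected monochromatic subgraph is a finite directed path. -/
def IsColored (K : PreGraph) (C : Set ℕ) : Prop :=
  Finite K.V ∧ K.ColorsIn C ∧
  (∀ (i : ℕ) (u u' v : K.V), K.F i u = some v → K.F i u' = some v → u = u') ∧
  (∀ (i : ℕ) (v : K.V) (k : ℕ), 0 < k → optIter (K.F i) k v ≠ some v)

/-- `|i - j| = 1`. -/
def Neighb (i j : ℕ) : Prop := i + 1 = j ∨ j + 1 = i

/-- `|i - j| ≥ 2`. -/
def Far (i j : ℕ) : Prop := i + 2 ≤ j ∨ j + 2 ≤ i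

instance (i j : ℕ) : Decidable (Neighb i j) := by unfold Neighb; infer_instance
instance (i j : ℕ) : Decidable (Far i j) := by unfold Far; infer_instance

/-- Axiom (A2) for the ordered pair of distinct colors `(i, j)`. -/
def A2at (K : PreGraph) (i j : ℕ) : Prop :=
  (∀ u v, K.F i u = some v →
    K.t j v ≤ K.t j u ∧ K.h j u ≤ K.h j v ∧
    ((K.h j u : ℤ) - (K.t j u : ℤ)) - ((K.h j v : ℤ) - (K.t j v : ℤ)) =
      (if Neighb i j then (-1 : ℤ) else 0)) ∧
  (∀ u v w, K.F i u = some v → K.F i v = some w →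
    2 * K.h j v ≤ K.h j u + K.h j w)

/-- Axiom (A3) for neighboring colors `i, j`. -/
def A3at (K : PreGraph) (i j : ℕ) : Prop :=
  (∀ u v v', K.F i u = some v → K.F j u = some v' →
    K.h j v = K.h j u →
    ((K.h i v' : ℤ) - (K.h i u : ℤ) = 1 ∧ ∃ w, K.F j v = some w ∧ K.F i v' = some w)) ∧
  (∀ u u' v, K.F i u = some v → K.F j u' = some v →
    (K.h j v : ℤ) - (K.h j u : ℤ) = 1 →
    (K.h i v = K.h i u' ∧ ∃ w, K.F j w = some u ∧ K.F i w = some u'))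

/-- Axiom (A4) (Verma relations) for neighboring colors `i, j`. -/
def A4at (K : PreGraph) (i j : ℕ) : Prop :=
  (∀ u v v', K.F i u = some v → K.F j u = some v' →
    (K.h j v : ℤ) - (K.h j u : ℤ) = 1 → (K.h i v' : ℤ) - (K.h i u : ℤ) = 1 →
    ∃ w, (((K.F i u).bind (K.F j)).bind (K.F j)).bind (K.F i) = some w ∧
         (((K.F j u).bind (K.F i)).bind (K.F i)).bind (K.F j) = some w) ∧
  (∀ u u' v, K.F i u = some v → K.F j u' = some v →
    K.h j v = K.h j u → K.h i v = K.h i u' →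
    ∃ w, (((K.Finv i v).bind (K.Finv j)).bind (K.Finv j)).bind (K.Finv i) = some w ∧
         (((K.Finv j v).bind (K.Finv i)).bind (K.Finv i)).bind (K.Finv j) = some w)

/-- Axiom (A5) for colors `i, j` at distance at least 2. -/
def A5at (K : PreGraph) (i j : ℕ) : Prop :=
  ∀ Fi ∈ ({K.F i, K.Finv i} : Set (K.V → Option K.V)),
  ∀ Fj ∈ ({K.F j, K.Finv j} : Set (K.V → Option K.V)),
  ∀ v, (Fi v).isSome → (Fj v).isSome →
    ∃ w, (Fi v).bind Fj = some w ∧ (Fj v).bind Fi = some w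

/-- `K` is a regular crystal of type A on the color set `C`
(an `A_{|C|}`-crystal when `C` is an integer interval). -/
def IsCrystalOn (K : PreGraph) (C : Set ℕ) : Prop :=
  IsColored K C ∧ K.Connected ∧
  (∀ i ∈ C, ∀ j ∈ C, i ≠ j → A2at K i j) ∧
  (∀ i ∈ C, ∀ j ∈ C, Neighb i j → A3at K i j ∧ A4at K i j) ∧
  (∀ i ∈ C, ∀ j ∈ C, Far i j → A5at K i j)

/-- `K` is an `A_n`-crystal (colors `1, …, n`). -/
def IsACrystal (n : ℕ) (K : PreGraph) : Prop := IsCrystalOn K (Set.Icc 1 n)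

/-- Apply a list of operators, head first. -/
def applyStr (K : PreGraph) : List ℕ → K.V → Option K.V
  | [], v => some v
  | i :: L, v => (K.F i v).bind (applyStr K L)

/-- The string `w_{m,k,j} = F_{o+j} F_{o+j+1} ⋯ F_{o+j+k-1}` (rightmost applied
first, i.e. head of the list applied first) for a crystal with colors `o+1, …, o+m`. -/
def wStr (o k j : ℕ) : List ℕ := (List.range k).map (fun m => o + j + k - 1 - m)

/-- The string `S_{m,k} = w_{m,k,m-k+1} ⋯ w_{m,k,2} w_{m,k,1}` for a crystal with
colors `o+1, …, o+m`. -/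
def SStr (o m k : ℕ) : List ℕ :=
  (List.range (m - k + 1)).flatMap fun jm => wStr o k (jm + 1)

/-- The string `S_{m,m}^{a_{o+m}} ⋯ S_{m,1}^{a_{o+1}}` for a crystal with colors
`o+1, …, o+m`, defining the principal vertex with coordinates `a`. -/
def prinStr (o m : ℕ) (a : ℕ → ℕ) : List ℕ :=
  (List.range m).flatMap fun km => (List.replicate (a (o + km + 1)) (SStr o m (km + 1))).flatten

def prinOpt (K : PreGraph) (o m : ℕ) (s : K.V) (a : ℕ → ℕ) : Option K.V :=
  applyStr K (prinStr o m a) s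

/-- `p` is the principal vertex with coordinates `a` of the crystal `K` with colors
`o+1, …, o+m` and source `s`. -/
def IsPrin (K : PreGraph) (o m : ℕ) (s : K.V) (a : ℕ → ℕ) (p : K.V) : Prop :=
  prinOpt K o m s a = some p

/-- The principal lattice of an `A_n`-crystal with source `s` and parameter `c`. -/
def PrinLat (K : PreGraph) (n : ℕ) (s : K.V) (c : ℕ → ℕ) : Set K.V :=
  {p | ∃ a : ℕ → ℕ, (∀ i, 1 ≤ i → i ≤ n → a i ≤ c i) ∧ IsPrin K 0 n s a p}

/-- One undirected step along an edge with color in `I`. -/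
def stepOn (K : PreGraph) (I : Set ℕ) (u v : K.V) : Prop :=
  ∃ i ∈ I, K.F i u = some v ∨ K.F i v = some u

/-- `u` lies in the same `I`-colored component as `v`. -/
def inComp (K : PreGraph) (I : Set ℕ) (v u : K.V) : Prop :=
  Relation.ReflTransGen (stepOn K I) v u

/-- The subcrystal of `K` with color set `I` containing `v` (the maximal connected
subgraph through `v` using only colors in `I`). -/
def PreGraph.sub (K : PreGraph) (I : Set ℕ) (v : K.V) : PreGraph where
  V := {u : K.V // inComp K I v u}
  F := fun i u =>
    if hi : i ∈ I then
      (K.F i u.1).pbind fun w hw =>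
        some ⟨w, Relation.ReflTransGen.tail u.2 ⟨i, hi, Or.inl (Option.mem_def.mp hw)⟩⟩
    else none

/-- Directed reachability. -/
def dirReach (K : PreGraph) (u v : K.V) : Prop :=
  Relation.ReflTransGen (fun a b => ∃ i, K.F i a = some b) u v

/-- The interval of `K` from `p` to `q`: the subgraph formed by all vertices and
edges lying on directed paths from `p` to `q`. -/
def PreGraph.interval (K : PreGraph) (p q : K.V) : PreGraph where
  V := {w : K.V // dirReach K p w ∧ dirReach K w q}
  F := fun i u =>
    (K.F i u.1).pbind fun w _ =>
      if hw : dirReach K p w ∧ dirReach K w q then some ⟨w, hw⟩ else none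

/-- The symmetric extract: restriction to self-complementary vertices,
with `ibar`-edges given by `chain i`. -/
def extract (K : PreGraph) (chain : ℕ → K.V → Option K.V) (σ : K.V → K.V) : PreGraph where
  V := {v : K.V // σ v = v}
  F := fun i u =>
    (chain i u.1).pbind fun w _ => if hw : σ w = w then some ⟨w, hw⟩ else none

/-- The operator chain for the color `ibar` of the symmetric extract of a
symmetric `A_{2n-1}`-crystal. -/
def chainB (K : PreGraph) (n : ℕ) (i : ℕ) (u : K.V) : Option K.V :=
  if 1 ≤ i ∧ i ≤ n then
    (if i = n then K.F n u else (K.F i u).bind (K.F (2 * n - i)))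
  else none

/-- The operator chain for the color `ibar` of the symmetric extract of a
symmetric `A_{2n}`-crystal. -/
def chainC (K : PreGraph) (n : ℕ) (i : ℕ) (u : K.V) : Option K.V :=
  if 1 ≤ i ∧ i ≤ n then
    (if i = n then (((K.F n u).bind (K.F (n + 1))).bind (K.F (n + 1))).bind (K.F n)
     else (K.F i u).bind (K.F (2 * n + 1 - i)))
  else none

/-- Symmetric extract from a symmetric `A_{2n-1}`-crystal. -/
def extractB (K : PreGraph) (n : ℕ) (σ : K.V → K.V) : PreGraph := extract K (chainB K n) σ

/-- Symmetric extract from a symmetric `A_{2n}`-crystal. -/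
def extractC (K : PreGraph) (n : ℕ) (σ : K.V → K.V) : PreGraph := extract K (chainC K n) σ

/-- Admissibility of a six-tuple `(x', y, x''; y', x, y'')` in the worm model. -/
def WormOK (g1 g2 : ℕ) : ℤ × ℤ × ℤ × ℤ × ℤ × ℤ → Prop
  | (x', y, x'', y', x, y'') =>
    (0 ≤ x' ∧ x' ≤ 2 * (g1 : ℤ)) ∧ (0 ≤ x'' ∧ x'' ≤ 2 * (g1 : ℤ)) ∧
    (0 ≤ x ∧ x ≤ 2 * (g1 : ℤ)) ∧
    (0 ≤ y' ∧ y' ≤ (g2 : ℤ)) ∧ (0 ≤ y'' ∧ y'' ≤ (g2 : ℤ)) ∧ (0 ≤ y ∧ y ≤ (g2 : ℤ)) ∧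
    (2 ∣ x') ∧ (2 ∣ x'') ∧ (y' ≤ y ∧ y ≤ y'') ∧ (x' ≤ x ∧ x ≤ x'') ∧
    (y' < y → x' = x) ∧ (y < y'' → x = x'')

/-- The candidate image of a worm under the operator `1tilde`. -/
def worm1 : ℤ × ℤ × ℤ × ℤ × ℤ × ℤ → ℤ × ℤ × ℤ × ℤ × ℤ × ℤ
  | (x', y, x'', y', x, y'') =>
    if 2 * x > x' + x'' then (x' + 2, y, x'', y', x, y'')
    else if x = x' ∧ x' = x'' ∧ y < y'' then (x', y + 1, x'', y', x, y'')
    else (x', y, x'' + 2, y', x, y'')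

/-- The candidate image of a worm under the operator `2tilde`. -/
def worm2 : ℤ × ℤ × ℤ × ℤ × ℤ × ℤ → ℤ × ℤ × ℤ × ℤ × ℤ × ℤ
  | (x', y, x'', y', x, y'') =>
    if 2 * y > y' + y'' then (x', y, x'', y' + 1, x, y'')
    else if y' = y ∧ y = y'' ∧ x < x'' then (x', y, x'', y', x + 1, y'')
    else (x', y, x'', y', x, y'' + 1)

/-- The worm graph `W(g1, g2)`, with colors `1 = 1tilde` and `2 = 2tilde`. -/
def WormGraph (g1 g2 : ℕ) : PreGraph where
  V := {w : ℤ × ℤ × ℤ × ℤ × ℤ × ℤ // WormOK g1 g2 w}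
  F := fun i u =>
    if i = 1 then
      (if h1 : WormOK g1 g2 (worm1 u.1) then some ⟨worm1 u.1, h1⟩ else none)
    else if i = 2 then
      (if h2 : WormOK g1 g2 (worm2 u.1) then some ⟨worm2 u.1, h2⟩ else none)
    else none

/-- Isomorphism of colored graphs, renaming colors via `φ`. -/
def IsoVia (K L : PreGraph) (φ : ℕ → ℕ) : Prop :=
  ∃ e : K.V ≃ L.V, ∀ i u v, K.F i u = some v ↔ L.F (φ i) (e u) = some (e v)

/-- The Cartesian product of an `i`-path of length `p` and a `j`-path of length `q`. -/
def boxGraph (i j p q : ℕ) : PreGraph where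
  V := Fin (p + 1) × Fin (q + 1)
  F := fun s u =>
    if s = i then
      (if h : (u.1 : ℕ) < p then some (⟨(u.1 : ℕ) + 1, by omega⟩, u.2) else none)
    else if s = j then
      (if h : (u.2 : ℕ) < q then some (u.1, ⟨(u.2 : ℕ) + 1, by omega⟩) else none)
    else none

/-- `B_n`-crystal: components with colors `n-1, n` are worm graphs,
with color `n-1` corresponding to `1tilde` and `n` to `2tilde`. -/
def IsBCrystal (n : ℕ) (B : PreGraph) : Prop :=
  IsColored B (Set.Icc 1 n) ∧ B.Connected ∧
  (∀ i ∈ Set.Icc 1 n, ∀ j ∈ Set.Icc 1 n, Far i j → A5at B i j) ∧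
  (∀ i j, 1 ≤ i → i < n → 1 ≤ j → j < n → Neighb i j →
    ∀ v : B.V, IsCrystalOn (B.sub {i, j} v) {i, j}) ∧
  (∀ v : B.V, ∃ g1 g2 : ℕ,
    IsoVia (B.sub ({n - 1, n} : Set ℕ) v) (WormGraph g1 g2)
      (fun x => if x = n - 1 then 1 else if x = n then 2 else 0))

/-- `C_n`-crystal: components with colors `n-1, n` are worm graphs,
with color `n-1` corresponding to `2tilde` and `n` to `1tilde`. -/
def IsCCrystal (n : ℕ) (B : PreGraph) : Prop :=
  IsColored B (Set.Icc 1 n) ∧ B.Connected ∧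
  (∀ i ∈ Set.Icc 1 n, ∀ j ∈ Set.Icc 1 n, Far i j → A5at B i j) ∧
  (∀ i j, 1 ≤ i → i < n → 1 ≤ j → j < n → Neighb i j →
    ∀ v : B.V, IsCrystalOn (B.sub {i, j} v) {i, j}) ∧
  (∀ v : B.V, ∃ g1 g2 : ℕ,
    IsoVia (B.sub ({n - 1, n} : Set ℕ) v) (WormGraph g1 g2)
      (fun x => if x = n - 1 then 2 else if x = n then 1 else 0))

/-! ### The crossing model -/

/-- `(k, i, j)` is a node `v_i^k(j)` of the supporting graph `G` for rank `n`. -/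
def isNode (n k i j : ℕ) : Prop :=
  1 ≤ j ∧ j ≤ i ∧ i ≤ n ∧ i - j + 1 ≤ k ∧ k ≤ n - j + 1

instance (n k i j : ℕ) : Decidable (isNode n k i j) := by
  unfold isNode; infer_instance

/-- Extension of a function on the nodes of `G` to the extended supporting graph:
extra nodes from which `G^k` is reachable get value `c k`, the others get `0`. -/
def fext (n : ℕ) (c : ℕ → ℕ) (f : ℕ × ℕ × ℕ → ℤ) (k i j : ℕ) : ℤ :=
  if isNode n k i j then f (k, i, j)
  else if j ≤ n - k + 1 then (c k : ℤ) else 0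

/-- The slack at the node `v_i^k(j)`. -/
def epsN (n : ℕ) (c : ℕ → ℕ) (f : ℕ × ℕ × ℕ → ℤ) (k i j : ℕ) : ℤ :=
  (fext n c f k (i - 1) (j - 1) - fext n c f k i j) -
    (fext n c f k i (j - 1) - fext n c f k (i + 1) j)

/-- The total slack at the multinode `V_i(j)`. -/
def epsTot (n : ℕ) (c : ℕ → ℕ) (f : ℕ × ℕ × ℕ → ℤ) (i j : ℕ) : ℤ :=
  ∑ k ∈ Finset.Icc (i - j + 1) (n - j + 1), epsN n c f k i j

/-- The reduced slack at the multinode `V_i(j)`. -/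
def teps (n : ℕ) (c : ℕ → ℕ) (f : ℕ × ℕ × ℕ → ℤ) (i j : ℕ) : ℤ :=
  if hj : (Finset.Icc 1 j).Nonempty then
    max 0 ((Finset.Icc 1 j).inf' hj fun p => ∑ q ∈ Finset.Icc p j, epsTot n c f i q)
  else 0

/-- `k0` satisfies the switch condition in the multinode `V_i(j)`. -/
def switchCond (n : ℕ) (f : ℕ × ℕ × ℕ → ℤ) (i j k0 : ℕ) : Prop :=
  i - j + 1 ≤ k0 ∧ k0 ≤ n - j + 1 ∧
  (∀ k, i - j + 1 ≤ k → k < k0 → isNode n k (i + 1) (j + 1) →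
    f (k, i, j) = f (k, i + 1, j + 1)) ∧
  (∀ k, k0 < k → k ≤ n - j + 1 → isNode n k (i + 1) j →
    f (k, i + 1, j) = f (k, i, j))

/-- The switch-node (first node with the switch property) of the multinode `V_i(j)`. -/
def switchNode (n : ℕ) (f : ℕ × ℕ × ℕ → ℤ) (i j : ℕ) : ℕ :=
  sInf {k0 | switchCond n f i j k0}

/-- Feasible functions of the crossing model (normalized to vanish off the nodes). -/
def Feasible (n : ℕ) (c : ℕ → ℕ) (f : ℕ × ℕ × ℕ → ℤ) : Prop :=
  (∀ k i j, ¬ isNode n k i j → f (k, i, j) = 0) ∧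
  (∀ k i j, isNode n k i j → isNode n k (i - 1) j → f (k, i - 1, j) ≤ f (k, i, j)) ∧
  (∀ k i j, isNode n k i j → isNode n k (i + 1) (j + 1) → f (k, i + 1, j + 1) ≤ f (k, i, j)) ∧
  (∀ k i j, isNode n k i j → 0 ≤ f (k, i, j) ∧ f (k, i, j) ≤ (c k : ℤ)) ∧
  (∀ i j, 1 ≤ j → j ≤ i → i ≤ n → ∃ k0, switchCond n f i j k0)

/-- Increase `f` by one at the node `(k, i, j)`. -/
def bump (f : ℕ × ℕ × ℕ → ℤ) (k i j : ℕ) : ℕ × ℕ × ℕ → ℤ :=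
  fun x => if x = (k, i, j) then f x + 1 else f x

/-- The crossing-model graph `Kscr(c)`: vertices are the feasible functions, and
the move `φ_i` increases `f` by one at the switch-node of the active multinode. -/
def Kscr (n : ℕ) (c : ℕ → ℕ) : PreGraph where
  V := {f : ℕ × ℕ × ℕ → ℤ // Feasible n c f}
  F := fun i f =>
    if 1 ≤ i ∧ i ≤ n ∧ ∃ j, 1 ≤ j ∧ j ≤ i ∧ 0 < teps n c f.1 i j then
      (let j := sSup {j | 1 ≤ j ∧ j ≤ i ∧ 0 < teps n c f.1 i j}
       let g := bump f.1 (switchNode n f.1 i j) i j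
       if hg : Feasible n c g then some ⟨g, hg⟩ else none)
    else none

/-- The function `f_{a,D}` of the crossing model. -/
def faD (n : ℕ) (a : ℕ → ℕ) (D : ℕ → ℤ) : ℕ × ℕ × ℕ → ℤ := fun x =>
  if isNode n x.1 x.2.1 x.2.2 then
    (if x.2.1 - x.2.2 + 1 = x.1 then (a x.1 : ℤ) else (a x.1 : ℤ) + min (D (x.1 - 1)) 0) +
    (if x.2.2 ≤ n - x.1 then max (D x.1) 0 else 0)
  else 0

/-! ### Descriptions of self-complementary vertices -/

/-- `(a1, a2, δ, l)` is the description of a self-complementary vertex `v` of a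
symmetric `A_3`-crystal `K` with source `s` and parameter `c`. -/
def IsDescB (K : PreGraph) (s : K.V) (c : ℕ → ℕ) (v : K.V) (q : ℕ × ℕ × ℤ × ℕ) : Prop :=
  q.2.2.2 = K.t 2 v ∧
  ∃ (a : ℕ → ℕ) (pa : K.V),
    a 1 = q.1 ∧ a 2 = q.2.1 ∧ a 3 = ((q.1 : ℤ) + max q.2.2.1 0).toNat ∧
    (∀ i, 1 ≤ i → i ≤ 3 → a i ≤ c i) ∧
    IsPrin K 0 3 s a pa ∧ inComp K (Set.Icc 1 2) pa v ∧
    0 ≤ (q.2.1 : ℤ) + q.2.2.1 ∧ 0 ≤ (a 3 : ℤ) - q.2.2.1 ∧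
    ∃ s' : (K.sub (Set.Icc 1 2) pa).V, IsSource (K.sub (Set.Icc 1 2) pa) s' ∧
    ∃ z : (K.sub (Set.Icc 1 2) pa).V,
      IsPrin (K.sub (Set.Icc 1 2) pa) 0 2 s'
        (fun i => if i = 1 then ((q.2.1 : ℤ) + q.2.2.1).toNat else ((a 3 : ℤ) - q.2.2.1).toNat) z ∧
      inComp K ({2} : Set ℕ) z.1 v

/-- The polytope of descriptions for a symmetric `A_3`-crystal with parameter `(c1, c2, c1)`. -/
def QuadB (c1 c2 : ℕ) : Set (ℕ × ℕ × ℤ × ℕ) :=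
  {q | q.1 ≤ c1 ∧ q.2.1 ≤ c2 ∧ -(q.2.1 : ℤ) ≤ q.2.2.1 ∧ (q.2.1 : ℤ) - (c2 : ℤ) ≤ q.2.2.1 ∧
       q.2.2.1 ≤ (c1 : ℤ) - (q.1 : ℤ) ∧ (q.2.2.2 : ℤ) ≤ (c2 : ℤ) + 2 * q.2.2.1}

/-- The worm associated to the description `(a1, a2, δ, l)`. -/
def wtupleB (a1 a2 : ℕ) (δ : ℤ) (l : ℕ) : ℤ × ℤ × ℤ × ℤ × ℤ × ℤ :=
  let a3 : ℤ := (a1 : ℤ) + max δ 0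
  let tr : ℤ × ℤ × ℤ :=
    if 0 ≤ δ then
      if (l : ℤ) ≤ (a2 : ℤ) then ((l : ℤ), 2 * (a1 : ℤ), (a2 : ℤ))
      else if (l : ℤ) ≤ (a2 : ℤ) + 2 * δ then
        ((a2 : ℤ), 2 * (a1 : ℤ) + (l : ℤ) - (a2 : ℤ), (a2 : ℤ))
      else ((a2 : ℤ), 2 * a3, (l : ℤ) - 2 * δ)
    else
      if (l : ℤ) ≤ (a2 : ℤ) + δ then ((l : ℤ), 2 * (a1 : ℤ), (a2 : ℤ) - δ)
      else ((a2 : ℤ) + δ, 2 * (a1 : ℤ), (l : ℤ) - 2 * δ)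
  (2 * (a1 : ℤ), (a2 : ℤ), 2 * a3, tr.1, tr.2.1, tr.2.2)

def wtQ (q : ℕ × ℕ × ℤ × ℕ) : ℤ × ℤ × ℤ × ℤ × ℤ × ℤ :=
  wtupleB q.1 q.2.1 q.2.2.1 q.2.2.2

/-- The string `(F_2 F_3)^r (F_3 F_2)^r` (rightmost applied first). -/
def diagStr (r : ℕ) : List ℕ :=
  (List.replicate r ([2, 3] : List ℕ)).flatten ++ (List.replicate r ([3, 2] : List ℕ)).flatten

/-- `(a1, a2, δ, ρ)` is the description of a self-complementary vertex `v` of a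
symmetric `A_4`-crystal `K` with source `s` and parameter `c`. -/
def IsDescC (K : PreGraph) (s : K.V) (c : ℕ → ℕ) (v : K.V) (q : ℕ × ℕ × ℤ × ℕ) : Prop :=
  ∃ (a : ℕ → ℕ) (pa : K.V),
    a 1 = q.1 ∧ a 2 = q.2.1 ∧ a 3 = ((q.2.1 : ℤ) + min q.2.2.1 0).toNat ∧
    a 4 = ((q.1 : ℤ) + max q.2.2.1 0).toNat ∧
    (∀ i, 1 ≤ i → i ≤ 4 → a i ≤ c i) ∧
    IsPrin K 0 4 s a pa ∧ inComp K (Set.Icc 1 3) pa v ∧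
    0 ≤ (q.2.1 : ℤ) + q.2.2.1 ∧ 0 ≤ (a 4 : ℤ) - q.2.2.1 ∧
    (∃ s' : (K.sub (Set.Icc 1 3) pa).V, IsSource (K.sub (Set.Icc 1 3) pa) s' ∧
     ∃ z : (K.sub (Set.Icc 1 3) pa).V,
       IsPrin (K.sub (Set.Icc 1 3) pa) 0 3 s'
         (fun i => if i = 1 then ((q.2.1 : ℤ) + q.2.2.1).toNat
                   else if i = 2 then a 3 else ((a 4 : ℤ) - q.2.2.1).toNat) z ∧
       inComp K (Set.Icc 2 3) z.1 v) ∧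
    (∃ stil : (K.sub (Set.Icc 2 3) v).V, IsSource (K.sub (Set.Icc 2 3) v) stil ∧
       applyStr (K.sub (Set.Icc 2 3) v) (diagStr q.2.2.2) stil =
         some ⟨v, Relation.ReflTransGen.refl⟩)

/-- The polytope of descriptions for a symmetric `A_4`-crystal with parameter
`(c1, c2, c2, c1)`. -/
def QuadC (c1 c2 : ℕ) : Set (ℕ × ℕ × ℤ × ℕ) :=
  {q | q.1 ≤ c1 ∧ q.2.1 ≤ c2 ∧ -(q.2.1 : ℤ) ≤ q.2.2.1 ∧
       q.2.2.1 ≤ (c1 : ℤ) - (q.1 : ℤ) ∧ (q.2.2.2 : ℤ) ≤ (c2 : ℤ) + q.2.2.1}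

end

/-- A seminormal crystal: partial operators `f i`, mutually inverse to `e i`, together with
the lengths `φ i`, `ε i` of the outgoing and incoming `i`-strings. -/
structure Crystal (V : Type) where
  f : ℕ → V → Option V
  e : ℕ → V → Option V
  φ : ℕ → V → ℕ
  ε : ℕ → V → ℕ
  f_iff_e : ∀ i u v, f i u = some v ↔ e i v = some u
  φ_zero : ∀ i u, φ i u = 0 → f i u = none
  ε_zero : ∀ i u, ε i u = 0 → e i u = none
  f_of_pos : ∀ i u, 0 < φ i u → ∃ v, f i u = some v
  e_of_pos : ∀ i u, 0 < ε i u → ∃ v, e i u = some v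
  φ_step : ∀ i u v, f i u = some v → φ i u = φ i v + 1
  ε_step : ∀ i u v, f i u = some v → ε i v = ε i u + 1

namespace Crystal

variable {V W : Type}

theorem f_inj (B : Crystal V) {i : ℕ} {u u' v : V} (h : B.f i u = some v)
    (h' : B.f i u' = some v) : u = u' := by
  rw [B.f_iff_e] at h h'
  have e : some u = some u' := h.symm.trans h'
  exact Option.some.inj e

/-- Reversal of all arrows. -/
def dual (B : Crystal V) : Crystal V where
  f := B.e
  e := B.f
  φ := B.ε
  ε := B.φ
  f_iff_e := fun i u v => (B.f_iff_e i v u).symm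
  φ_zero := B.ε_zero
  ε_zero := B.φ_zero
  f_of_pos := B.e_of_pos
  e_of_pos := B.f_of_pos
  φ_step := fun i u v h => B.ε_step i v u ((B.f_iff_e i v u).2 h)
  ε_step := fun i u v h => B.φ_step i v u ((B.f_iff_e i v u).2 h)

/-- The outgoing half of the local axioms for an ordered pair of neighbouring colors. -/
structure Half (B : Crystal V) (i j : ℕ) : Prop where
  wt : ∀ u v, B.f i u = some v →
    (B.φ j v = B.φ j u + 1 ∧ B.ε j v = B.ε j u) ∨ (B.φ j v = B.φ j u ∧ B.ε j u = B.ε j v + 1)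
  conv : ∀ u v w, B.f i u = some v → B.f i v = some w →
    B.φ j v = B.φ j u + 1 → B.φ j w = B.φ j v + 1
  sq : ∀ u v v', B.f i u = some v → B.f j u = some v' → B.φ j v = B.φ j u →
    B.φ i v' = B.φ i u + 1 ∧ ∃ w, B.f j v = some w ∧ B.f i v' = some w
  verma : ∀ u v v', B.f i u = some v → B.f j u = some v' → B.φ j v = B.φ j u + 1 →
    B.φ i v' = B.φ i u + 1 → ∃ a b c d w, B.f j v = some a ∧ B.f j a = some b ∧
      B.f i b = some w ∧ B.f i v' = some c ∧ B.f i c = some d ∧ B.f j d = some w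

/-- The local axioms for a pair of neighbouring colors. -/
structure Regular (B : Crystal V) (i j : ℕ) : Prop where
  half : Half B i j
  half' : Half B j i
  dual_half : Half B.dual i j
  dual_half' : Half B.dual j i

theorem Regular.symm {B : Crystal V} {i j : ℕ} (h : Regular B i j) : Regular B j i :=
  ⟨h.half', h.half, h.dual_half', h.dual_half⟩

theorem Regular.dual {B : Crystal V} {i j : ℕ} (h : Regular B i j) : Regular B.dual i j :=
  ⟨h.dual_half, h.dual_half', h.half, h.half'⟩

/-- The local axioms for an ordered pair of distant colors. -/
structure FarPair (B : Crystal V) (i j : ℕ) : Prop where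
  wt : ∀ u v, B.f i u = some v → B.φ j v = B.φ j u ∧ B.ε j v = B.ε j u
  sq : ∀ u v v', B.f i u = some v → B.f j u = some v' →
    ∃ w, B.f j v = some w ∧ B.f i v' = some w
  dual_sq : ∀ u v x, B.f i u = some v → B.f j x = some v →
    ∃ w, B.f j w = some u ∧ B.f i w = some x

/-- After an `i`-edge with label `1`, a `j`-edge has label `0`. -/
theorem Regular.label_zero_of_one {B : Crystal V} {i j : ℕ} (h : Regular B i j) {u v w : V}
    (huv : B.f i u = some v) (hvw : B.f j v = some w) (hl : B.φ j v = B.φ j u + 1) :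
    B.φ i w = B.φ i v ∧ B.ε i v = B.ε i w + 1 := by
  rcases h.half'.wt v w hvw with ⟨h1, h2⟩ | h1
  · exfalso
    have hε := B.ε_step i u v huv
    obtain ⟨z, hz⟩ := B.e_of_pos i w (by omega)
    obtain ⟨_, y, hy1, hy2⟩ := h.dual_half'.sq w v z ((B.f_iff_e _ _ _).1 hvw) hz h2.symm
    have hyu : y = u := by
      have := (B.f_iff_e i u v).1 huv
      simp only [Crystal.dual] at hy1
      rw [this] at hy1
      exact (Option.some.inj hy1).symm
    subst hyu
    have hyz : B.f j y = some z := (B.f_iff_e _ _ _).2 hy2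
    have hzw : B.f i z = some w := (B.f_iff_e _ _ _).2 hz
    have e1 := B.φ_step j v w hvw
    have e2 := B.φ_step j y z hyz
    have h3 := h.half.wt z w hzw
    have e3 := B.ε_step j v w hvw
    have e4 := B.ε_step j y z hyz
    have h5 : B.φ j w = B.φ j z + 1 := by omega
    have := h.dual_half.sq w z v ((B.f_iff_e _ _ _).1 hzw) ((B.f_iff_e _ _ _).1 hvw)
    simp only [Crystal.dual] at this
    have := (this (by omega)).1
    omega
  · exact h1

/-- The labels along one side of a Verma octagon. -/
theorem Regular.verma_labels {B : Crystal V} {i j : ℕ} (h : Regular B i j)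
    {u v v' a b c d w : V} (huv : B.f i u = some v)
    (hl : B.φ j v = B.φ j u + 1) (hl' : B.φ i v' = B.φ i u + 1)
    (hva : B.f j v = some a) (hab : B.f j a = some b) (hbw : B.f i b = some w)
    (hvc : B.f i v' = some c) (hcd : B.f i c = some d) (hdw : B.f j d = some w) :
    (B.φ i a = B.φ i v ∧ B.ε i v = B.ε i a + 1) ∧
      (B.φ i b = B.φ i a + 1 ∧ B.ε i b = B.ε i a) := by
  have h1 := h.label_zero_of_one huv hva hl
  refine ⟨h1, ?_⟩
  have h2 := h.half'.wt a b hab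
  have := B.φ_step _ _ _ huv
  have := B.φ_step _ _ _ hbw
  have := B.φ_step _ _ _ hvc
  have := B.φ_step _ _ _ hcd
  have := h.half'.wt d w hdw
  omega

/-- The labels at the origin of a commuting square obtained by going backwards. -/
theorem Regular.exists_square {B : Crystal V} {i j : ℕ} (h : Regular B i j) {u u' v : V}
    (hu : B.f i u = some v) (hu' : B.f j u' = some v) (hl : B.φ j v = B.φ j u + 1) :
    ∃ w, B.f j w = some u ∧ B.f i w = some u' ∧ B.φ i u = B.φ i w := by
  have h0 := h.half.wt u v hu
  obtain ⟨h1, w, hw, hw'⟩ := h.dual_half.sq v u u' ((B.f_iff_e _ _ _).1 hu)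
    ((B.f_iff_e _ _ _).1 hu') (by simp only [Crystal.dual]; omega)
  have hw := (B.f_iff_e _ _ _).2 hw
  have hw' := (B.f_iff_e _ _ _).2 hw'
  refine ⟨w, hw, hw', ?_⟩
  simp only [Crystal.dual] at h1
  have := h.half'.wt u' v hu'
  have := B.φ_step _ _ _ hu
  have := B.φ_step _ _ _ hw'
  omega

/-- Going backwards from two incoming edges with labels `0`, one finds a Verma octagon whose
origin has outgoing edges with labels `1`. -/
theorem Regular.exists_octagon {B : Crystal V} {i j : ℕ} (h : Regular B i j) {u u' v : V}
    (hu : B.f i u = some v) (hu' : B.f j u' = some v) (hl : B.φ j v = B.φ j u)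
    (hl' : B.φ i v = B.φ i u') :
    ∃ w a1 a2 b1 b2, B.f i w = some a1 ∧ B.f j a1 = some a2 ∧ B.f j a2 = some u ∧
      B.f j w = some b1 ∧ B.f i b1 = some b2 ∧ B.f i b2 = some u' ∧
      B.φ j a1 = B.φ j w + 1 ∧ B.φ i b1 = B.φ i w + 1 := by
  have h0 := h.half.wt u v hu
  have h0' := h.half'.wt u' v hu'
  obtain ⟨a2, a1, b2, b1, w, h1, h2, h3, h4, h5, h6⟩ := h.dual_half.verma v u u'
    ((B.f_iff_e _ _ _).1 hu) ((B.f_iff_e _ _ _).1 hu') (by simp only [Crystal.dual]; omega)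
    (by simp only [Crystal.dual]; omega)
  replace h1 := (B.f_iff_e _ _ _).2 h1
  replace h2 := (B.f_iff_e _ _ _).2 h2
  replace h3 := (B.f_iff_e _ _ _).2 h3
  replace h4 := (B.f_iff_e _ _ _).2 h4
  replace h5 := (B.f_iff_e _ _ _).2 h5
  replace h6 := (B.f_iff_e _ _ _).2 h6
  have s1 := B.φ_step _ _ _ h1
  have s2 := B.φ_step _ _ _ h2
  have s3 := B.φ_step _ _ _ h3
  have s4 := B.φ_step _ _ _ h4
  have s5 := B.φ_step _ _ _ h5
  have s6 := B.φ_step _ _ _ h6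
  have s7 := B.φ_step _ _ _ hu'
  have s8 := B.φ_step _ _ _ hu
  -- a label `0` at the origin forces two consecutive squares, contradicting the labels at `v`
  have key : ∀ {i j : ℕ} {u u' w a1 a2 b1 b2 : V}, Regular B i j → B.f i u = some v →
      B.f j u' = some v → B.φ j v = B.φ j u → B.φ i v = B.φ i u' →
      B.f i w = some a1 → B.f j a1 = some a2 → B.f j a2 = some u → B.f j w = some b1 →
      B.f i b1 = some b2 → B.f i b2 = some u' → B.φ j a1 ≠ B.φ j w := by
    intro i j u u' w a1 a2 b1 b2 h hu hu' hl hl' h3 h2 h1 h6 h5 h4 hc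
    obtain ⟨_, z, hz, hz'⟩ := h.half.sq w a1 b1 h3 h6 hc
    obtain rfl : a2 = z := by simpa [h2] using hz
    obtain rfl : b2 = a2 := by simpa [h5] using hz'
    have s1 := B.φ_step _ _ _ h1
    have s2 := B.φ_step _ _ _ h2
    have s4 := B.φ_step _ _ _ h4
    have s7 := B.φ_step _ _ _ hu
    have s8 := B.φ_step _ _ _ hu'
    have := (h.half.sq b2 u' u h4 h1 (by omega)).1
    omega
  have k1 := key h hu hu' hl hl' h3 h2 h1 h6 h5 h4
  have k2 := key h.symm hu' hu hl' hl h6 h5 h4 h3 h2 h1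
  have := h.half.wt w a1 h3
  have := h.half'.wt w b1 h6
  exact ⟨w, a1, a2, b1, b2, h3, h2, h1, h6, h5, h4, by omega, by omega⟩

end Crystal

namespace Crystal

variable {V W : Type}

/-- The local axioms of a regular crystal of type `A` with colors `1, …, 4`. -/
structure IsRegular (B : Crystal V) : Prop where
  color : ∀ i u v, B.f i u = some v → 1 ≤ i ∧ i ≤ 4
  near : ∀ i j, 1 ≤ i → i ≤ 4 → 1 ≤ j → j ≤ 4 → Neighb i j → Regular B i j
  far : ∀ i j, 1 ≤ i → i ≤ 4 → 1 ≤ j → j ≤ 4 → Far i j → FarPair B i j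

theorem eq_or_neighb_or_far (i j : ℕ) : i = j ∨ Neighb i j ∨ Far i j := by
  unfold Neighb Far; omega

/-- `u` is reached from `s` by a directed path of length `n`. -/
inductive Reach (B : Crystal V) (s : V) : ℕ → V → Prop
  | zero : Reach B s 0 s
  | succ {n i u v} : Reach B s n u → B.f i u = some v → Reach B s (n + 1) v

theorem Reach.pred {B : Crystal V} (hB : B.IsRegular) {s : V} (hs : ∀ i, B.ε i s = 0) :
    ∀ {n : ℕ} {u w : V} {j : ℕ}, Reach B s n u → B.f j w = some u →
      ∃ m, n = m + 1 ∧ Reach B s m w := by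
  intro n
  induction n using Nat.strong_induction_on with
  | _ n ih =>
    intro u w j hu hw
    cases hu with
    | zero =>
      have := B.ε_step _ _ _ hw
      have := hs j
      omega
    | @succ n i u₀ _ hu₀ hi =>
      refine ⟨n, rfl, ?_⟩
      have ci := hB.color _ _ _ hi
      have cj := hB.color _ _ _ hw
      have square : ∀ z, B.f j z = some u₀ → B.f i z = some w → Reach B s n w := by
        intro z hz hz'
        obtain ⟨m, rfl, hm⟩ := ih n (by omega) hu₀ hz
        exact hm.succ hz'
      rcases eq_or_neighb_or_far i j with rfl | hij | hij
      · rwa [B.f_inj hw hi]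
      · have hR := hB.near i j ci.1 ci.2 cj.1 cj.2 hij
        rcases hR.half.wt _ _ hi with ⟨h1, _⟩ | ⟨h1, _⟩
        · obtain ⟨z, hz, hz', _⟩ := hR.exists_square hi hw h1
          exact square z hz hz'
        · rcases hR.half'.wt _ _ hw with ⟨h2, _⟩ | ⟨h2, _⟩
          · obtain ⟨z, hz, hz', _⟩ := hR.symm.exists_square hw hi h2
            exact square z hz' hz
          · obtain ⟨z, a1, a2, b1, b2, e1, e2, e3, e4, e5, e6, _, _⟩ :=
              hR.exists_octagon hi hw h1 h2
            obtain ⟨m₁, rfl, hm₁⟩ := ih n (by omega) hu₀ e3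
            obtain ⟨m₂, rfl, hm₂⟩ := ih _ (by omega) hm₁ e2
            obtain ⟨m₃, rfl, hm₃⟩ := ih _ (by omega) hm₂ e1
            exact ((hm₃.succ e4).succ e5).succ e6
      · obtain ⟨z, hz, hz'⟩ := (hB.far i j ci.1 ci.2 cj.1 cj.2 hij).dual_sq _ _ _ hi hw
        exact square z hz hz'

theorem Reach.level_unique {B : Crystal V} (hB : B.IsRegular) {s : V} (hs : ∀ i, B.ε i s = 0)
    {n : ℕ} : ∀ {m : ℕ} {u : V}, Reach B s n u → Reach B s m u → n = m := by
  induction n with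
  | zero =>
    intro m u hn hm
    cases hn
    cases hm with
    | zero => rfl
    | @succ m i u _ _ hi =>
      have := B.ε_step _ _ _ hi
      have := hs i
      omega
  | succ n ih =>
    intro m u hn hm
    cases hn with
    | succ hn hi =>
      obtain ⟨k, rfl, hk⟩ := hm.pred hB hs hi
      rw [ih hn hk]

/-- `u` and `x` are reached from `s` and `t` by the same string of `n` operators. -/
inductive Paired (A : Crystal V) (B : Crystal W) (s : V) (t : W) : ℕ → V → W → Prop
  | zero : Paired A B s t 0 s t
  | succ {n i u x v y} : Paired A B s t n u x → A.f i u = some v → B.f i x = some y →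
      Paired A B s t (n + 1) v y

section Unique

variable {A : Crystal V} {B : Crystal W} {s : V} {t : W}

theorem Paired.symm {n : ℕ} {u : V} {x : W} (h : Paired A B s t n u x) :
    Paired B A t s n x u := by
  induction h with
  | zero => exact .zero
  | succ _ h1 h2 ih => exact ih.succ h2 h1

theorem Paired.reach {n : ℕ} {u : V} {x : W} (h : Paired A B s t n u x) : Reach A s n u := by
  induction h with
  | zero => exact .zero
  | succ _ h1 _ ih => exact ih.succ h1

/-- The string lengths of paired vertices of level at most `n` agree. -/
def SameLengths (A : Crystal V) (B : Crystal W) (s : V) (t : W) (n : ℕ) : Prop :=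
  ∀ m u x, m ≤ n → Paired A B s t m u x → ∀ i, 1 ≤ i → i ≤ 4 → A.φ i u = B.φ i x ∧ A.ε i u = B.ε i x

/-- Pairing is functional at levels at most `n`. -/
def PairedFun (A : Crystal V) (B : Crystal W) (s : V) (t : W) (n : ℕ) : Prop :=
  ∀ m u x y, m ≤ n → Paired A B s t m u x → Paired A B s t m u y → x = y

theorem SameLengths.symm {n : ℕ} (h : SameLengths A B s t n) : SameLengths B A t s n :=
  fun m u x hm hp i h1 h2 => ⟨(h m x u hm hp.symm i h1 h2).1.symm, (h m x u hm hp.symm i h1 h2).2.symm⟩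

theorem SameLengths.exists_succ (hA : A.IsRegular) {n m i : ℕ} {u v : V} {x : W}
    (h : SameLengths A B s t n) (hm : m ≤ n) (hp : Paired A B s t m u x)
    (hf : A.f i u = some v) : ∃ y, B.f i x = some y ∧ Paired A B s t (m + 1) v y := by
  have ci := hA.color _ _ _ hf
  have h1 := h m u x hm hp i ci.1 ci.2
  have := A.φ_step _ _ _ hf
  obtain ⟨y, hy⟩ := B.f_of_pos i x (by omega)
  exact ⟨y, hy, hp.succ hf hy⟩

theorem SameLengths.exists_paired (hA : A.IsRegular) {n m : ℕ} {u : V}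
    (h : SameLengths A B s t n) (hm : m ≤ n + 1) (hu : Reach A s m u) :
    ∃ x, Paired A B s t m u x := by
  induction hu with
  | zero => exact ⟨t, .zero⟩
  | succ _ hf ih =>
    obtain ⟨x, hx⟩ := ih (by omega)
    obtain ⟨y, _, hy⟩ := h.exists_succ hA (by omega) hx hf
    exact ⟨y, hy⟩

theorem pairedFun_succ (hA : A.IsRegular) (hB : B.IsRegular) (hs : ∀ i, A.ε i s = 0) {n : ℕ}
    (hL : SameLengths A B s t n) (hF : PairedFun A B s t n) : PairedFun A B s t (n + 1) := by
  -- partner of a predecessor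
  have hpred : ∀ {m u w x j}, m ≤ n → Paired A B s t m u x → A.f j w = some u →
      ∃ k z, m = k + 1 ∧ Paired A B s t k w z ∧ B.f j z = some x := by
    intro m u w x j hm hp hw
    obtain ⟨k, rfl, hk⟩ := hp.reach.pred hA hs hw
    obtain ⟨z, hz⟩ := hL.exists_paired hA (by omega) hk
    obtain ⟨x', hx', hp'⟩ := hL.exists_succ hA (by omega) hz hw
    exact ⟨k, z, rfl, hz, by rw [hx', hF _ _ _ _ hm hp hp']⟩
  intro m v y y' hm hp hp'
  rcases Nat.lt_or_ge n m with hnm | hnm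
  swap
  · exact hF m v y y' hnm hp hp'
  obtain rfl : m = n + 1 := by omega
  cases hp with
  | @succ _ i u x _ _ hp hi hi' =>
  cases hp' with
  | @succ _ j u' x' _ _ hp' hj hj' =>
  have ci := hA.color _ _ _ hi
  have cj := hA.color _ _ _ hj
  -- partner of the origin of a square
  have square : ∀ w, A.f j w = some u → A.f i w = some u' →
      ∃ k z, n = k + 1 ∧ Paired A B s t k w z ∧ B.f j z = some x ∧ B.f i z = some x' := by
    intro w hw hw'
    obtain ⟨k, z, rfl, hz, hzx⟩ := hpred le_rfl hp hw
    obtain ⟨k', z', hk', hz', hzx'⟩ := hpred le_rfl hp' hw'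
    obtain rfl : k = k' := by omega
    obtain rfl := hF _ _ _ _ (by omega) hz hz'
    exact ⟨k, z, rfl, hz, hzx, hzx'⟩
  rcases eq_or_neighb_or_far i j with rfl | hij | hij
  · obtain rfl := A.f_inj hi hj
    obtain rfl := hF _ _ _ _ le_rfl hp hp'
    simpa [hi'] using hj'
  · have hRA := hA.near i j ci.1 ci.2 cj.1 cj.2 hij
    have hRB := hB.near i j ci.1 ci.2 cj.1 cj.2 hij
    rcases hRA.half.wt _ _ hi with ⟨h1, _⟩ | ⟨h1, _⟩
    · obtain ⟨w, hw, hw', hl⟩ := hRA.exists_square hi hj h1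
      obtain ⟨k, z, rfl, hz, hzx, hzx'⟩ := square w hw hw'
      have l1 := (hL _ _ _ (by omega) hz i ci.1 ci.2).1
      have l2 := (hL _ _ _ (by omega) hp i ci.1 ci.2).1
      obtain ⟨_, q, hq, hq'⟩ := hRB.half'.sq z x x' hzx hzx' (by omega)
      rw [hi'] at hq
      rw [hj'] at hq'
      exact (Option.some.inj hq).trans (Option.some.inj hq').symm
    · rcases hRA.half'.wt _ _ hj with ⟨h2, _⟩ | ⟨h2, _⟩
      · obtain ⟨w, hw', hw, hl⟩ := hRA.symm.exists_square hj hi h2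
        obtain ⟨k, z, rfl, hz, hzx, hzx'⟩ := square w hw hw'
        have l1 := (hL _ _ _ (by omega) hz j cj.1 cj.2).1
        have l2 := (hL _ _ _ (by omega) hp' j cj.1 cj.2).1
        obtain ⟨_, q, hq, hq'⟩ := hRB.half.sq z x' x hzx' hzx (by omega)
        rw [hj'] at hq
        rw [hi'] at hq'
        exact (Option.some.inj hq').trans (Option.some.inj hq).symm
      · obtain ⟨w, a1, a2, b1, b2, e1, e2, e3, e4, e5, e6, l1, l2⟩ :=
          hRA.exists_octagon hi hj h1 h2
        obtain ⟨k, x2, rfl, p2, g3⟩ := hpred le_rfl hp e3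
        obtain ⟨k, x1, rfl, p1, g2⟩ := hpred (by omega) p2 e2
        obtain ⟨k, z, rfl, p0, g1⟩ := hpred (by omega) p1 e1
        obtain ⟨k', z2, hk, q2, g6⟩ := hpred le_rfl hp' e6
        obtain rfl : k' = k + 1 + 1 := by omega
        obtain ⟨k', z1, hk, q1, g5⟩ := hpred (by omega) q2 e5
        obtain rfl : k' = k + 1 := by omega
        obtain ⟨k', z', hk, q0, g4⟩ := hpred (by omega) q1 e4
        obtain rfl : k' = k := by omega
        obtain rfl := hF _ _ _ _ (by omega) p0 q0
        have m1 := (hL _ _ _ (by omega) p0 i ci.1 ci.2).1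
        have m2 := (hL _ _ _ (by omega) p0 j cj.1 cj.2).1
        have m3 := (hL _ _ _ (by omega) p1 j cj.1 cj.2).1
        have m4 := (hL _ _ _ (by omega) q1 i ci.1 ci.2).1
        obtain ⟨a, b, c, d, r, r1, r2, r3, r4, r5, r6⟩ :=
          hRB.half.verma z x1 z1 g1 g4 (by omega) (by omega)
        obtain rfl : x2 = a := by simpa [g2] using r1
        obtain rfl : x = b := by simpa [g3] using r2
        obtain rfl : z2 = c := by simpa [g5] using r4
        obtain rfl : x' = d := by simpa [g6] using r5
        rw [hi'] at r3
        rw [hj'] at r6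
        exact (Option.some.inj r3).trans (Option.some.inj r6).symm
  · obtain ⟨w, hw, hw'⟩ := (hA.far i j ci.1 ci.2 cj.1 cj.2 hij).dual_sq _ _ _ hi hj
    obtain ⟨k, z, rfl, hz, hzx, hzx'⟩ := square w hw hw'
    obtain ⟨q, hq, hq'⟩ := (hB.far i j ci.1 ci.2 cj.1 cj.2 hij).sq z x' x hzx' hzx
    rw [hj'] at hq
    rw [hi'] at hq'
    exact (Option.some.inj hq').trans (Option.some.inj hq).symm

theorem sameLengths_of_ε_pos (hA : A.IsRegular) (hs : ∀ i, A.ε i s = 0) {n : ℕ}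
    (hL : SameLengths A B s t n) (hF : PairedFun A B s t (n + 1)) {v : V} {y : W}
    (hp : Paired A B s t (n + 1) v y) {k : ℕ} (hk : 1 ≤ k ∧ k ≤ 4) (hpos : 0 < A.ε k v) :
    A.φ k v = B.φ k y ∧ A.ε k v = B.ε k y := by
  obtain ⟨u, hu⟩ := A.e_of_pos k v hpos
  replace hu := (A.f_iff_e _ _ _).2 hu
  obtain ⟨m, hm, hr⟩ := hp.reach.pred hA hs hu
  obtain rfl : m = n := by omega
  obtain ⟨x, hx⟩ := hL.exists_paired hA (by omega) hr
  obtain ⟨y', hy', hp'⟩ := hL.exists_succ hA le_rfl hx hu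
  obtain rfl := hF _ _ _ _ le_rfl hp hp'
  have h1 := hL _ _ _ le_rfl hx k hk.1 hk.2
  have := A.φ_step _ _ _ hu
  have := A.ε_step _ _ _ hu
  have := B.φ_step _ _ _ hy'
  have := B.ε_step _ _ _ hy'
  omega

theorem paired_unique (hA : A.IsRegular) (hB : B.IsRegular) (hs : ∀ i, A.ε i s = 0)
    (ht : ∀ i, B.ε i t = 0) (hφ : ∀ i, 1 ≤ i → i ≤ 4 → A.φ i s = B.φ i t) (n : ℕ) :
    SameLengths A B s t n ∧ PairedFun A B s t n ∧ PairedFun B A t s n := by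
  induction n with
  | zero =>
    refine ⟨?_, ?_, ?_⟩
    · intro m u x hm hp i h1 h2
      obtain rfl : m = 0 := by omega
      cases hp
      simp [hφ i h1 h2, hs, ht]
    · intro m u x y hm hp hp'
      obtain rfl : m = 0 := by omega
      cases hp; cases hp'; rfl
    · intro m u x y hm hp hp'
      obtain rfl : m = 0 := by omega
      cases hp; cases hp'; rfl
  | succ n ih =>
    obtain ⟨hL, hF, hF'⟩ := ih
    have hF1 := pairedFun_succ hA hB hs hL hF
    have hF1' := pairedFun_succ hB hA ht hL.symm hF'
    refine ⟨?_, hF1, hF1'⟩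
    intro m v y hm hp k hk1 hk2
    rcases Nat.lt_or_ge n m with hnm | hnm
    swap
    · exact hL m v y hnm hp k hk1 hk2
    obtain rfl : m = n + 1 := by omega
    rcases Nat.eq_zero_or_pos (A.ε k v) with h0 | h0
    swap
    · exact sameLengths_of_ε_pos hA hs hL hF1 hp ⟨hk1, hk2⟩ h0
    rcases Nat.eq_zero_or_pos (B.ε k y) with h0' | h0'
    swap
    · have := sameLengths_of_ε_pos hB ht hL.symm hF1' hp.symm ⟨hk1, hk2⟩ h0'
      exact ⟨this.1.symm, this.2.symm⟩
    cases hp with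
    | @succ _ i u x _ _ hp hi hi' =>
    have ci := hA.color _ _ _ hi
    have h1 := hL _ _ _ le_rfl hp k hk1 hk2
    rcases eq_or_neighb_or_far i k with rfl | hik | hik
    · have := A.ε_step _ _ _ hi
      omega
    · have := (hA.near i k ci.1 ci.2 hk1 hk2 hik).half.wt _ _ hi
      have := (hB.near i k ci.1 ci.2 hk1 hk2 hik).half.wt _ _ hi'
      omega
    · have := (hA.far i k ci.1 ci.2 hk1 hk2 hik).wt _ _ hi
      have := (hB.far i k ci.1 ci.2 hk1 hk2 hik).wt _ _ hi'
      omega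

/-- A regular crystal generated by its source embeds into any regular crystal having a source
with the same string lengths. -/
theorem exists_embedding (hA : A.IsRegular) (hB : B.IsRegular) (hs : ∀ i, A.ε i s = 0)
    (ht : ∀ i, B.ε i t = 0) (hφ : ∀ i, 1 ≤ i → i ≤ 4 → A.φ i s = B.φ i t)
    (hreach : ∀ u, ∃ n, Reach A s n u) :
    ∃ π : V → W, Function.Injective π ∧ π s = t ∧ (∀ i u, (A.f i u).map π = B.f i (π u)) ∧
      (∀ i u y, B.f i y = some (π u) → ∃ v, π v = y ∧ A.f i v = some u) ∧
      (∀ i u, 1 ≤ i → i ≤ 4 → A.ε i u = B.ε i (π u)) := by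
  have key := paired_unique hA hB hs ht hφ
  have hex : ∀ u, ∃ x n, Paired A B s t n u x := by
    intro u
    obtain ⟨n, hn⟩ := hreach u
    obtain ⟨x, hx⟩ := (key n).1.exists_paired hA (by omega) hn
    exact ⟨x, n, hx⟩
  choose π l hπ using hex
  have huniq : ∀ {n u x}, Paired A B s t n u x → x = π u := by
    intro n u x hp
    obtain rfl := hp.reach.level_unique hA hs (hπ u).reach
    exact (key _).2.1 _ _ _ _ le_rfl hp (hπ u)
  have hinj : ∀ {n u x v}, Paired A B s t n u x → π v = x → v = u := by
    intro n u x v hp hv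
    have hq := hπ v
    rw [hv] at hq
    obtain rfl := hp.symm.reach.level_unique hB ht hq.symm.reach
    exact (key _).2.2 _ _ _ _ le_rfl hq.symm hp.symm
  refine ⟨π, fun u v h => hinj (hπ v) h, (huniq .zero).symm, ?_, ?_, ?_⟩
  · intro i u
    cases hf : A.f i u with
    | some v =>
      obtain ⟨y, hy, hp⟩ := (key _).1.exists_succ hA le_rfl (hπ u) hf
      simp [hy, huniq hp]
    | none =>
      cases hf' : B.f i (π u) with
      | none => rfl
      | some y =>
        obtain ⟨v, hv, _⟩ := (key _).1.symm.exists_succ hB le_rfl (hπ u).symm hf'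
        simp [hf] at hv
  · intro i u y hy
    obtain ⟨m, hm, hr⟩ := (hπ u).symm.reach.pred hB ht hy
    obtain ⟨v, hv⟩ := (key _).1.symm.exists_paired hB (by omega : m ≤ l u + 1) hr
    obtain ⟨u', hu', hp⟩ := (key _).1.symm.exists_succ hB (by omega : m ≤ l u) hv hy
    refine ⟨v, (huniq hv.symm).symm, ?_⟩
    rw [hu', hinj hp.symm rfl]
  · intro i u h1 h2
    exact ((key _).1 _ _ _ le_rfl (hπ u) i h1 h2).2

end Unique

end Crystal

namespace Crystal

variable {V W : Type}

theorem map_mk_left_eq_some {o : Option V} {a : V} {b b' : W} :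
    o.map (·, b) = some (a, b') ↔ o = some a ∧ b = b' := by
  cases o <;> simp

theorem map_mk_right_eq_some {o : Option W} {a a' : V} {b : W} :
    o.map (a, ·) = some (a', b) ↔ o = some b ∧ a = a' := by
  cases o <;> simp [and_comm]

/-- The tensor product of two crystals. -/
def tens (A : Crystal V) (B : Crystal W) : Crystal (V × W) where
  f i x := if B.ε i x.2 < A.φ i x.1 then (A.f i x.1).map (·, x.2) else (B.f i x.2).map (x.1, ·)
  e i x := if B.ε i x.2 ≤ A.φ i x.1 then (A.e i x.1).map (·, x.2) else (B.e i x.2).map (x.1, ·)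
  φ i x := B.φ i x.2 + (A.φ i x.1 - B.ε i x.2)
  ε i x := A.ε i x.1 + (B.ε i x.2 - A.φ i x.1)
  f_iff_e := by
    rintro i ⟨a, b⟩ ⟨a', b'⟩
    have hA := A.f_iff_e i a a'
    have hB := B.f_iff_e i b b'
    have sA := A.φ_step i a a'
    have sB := B.ε_step i b b'
    dsimp only
    split_ifs with h1 h2 h2 <;> simp only [map_mk_left_eq_some, map_mk_right_eq_some] <;>
      constructor <;> rintro ⟨h3, rfl⟩
    · exact ⟨hA.1 h3, rfl⟩
    · exact ⟨hA.2 h3, rfl⟩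
    · have := sA h3; omega
    · have := sB (hB.2 h3); omega
    · have := sB h3; omega
    · have := sA (hA.2 h3); omega
    · exact ⟨hB.1 h3, rfl⟩
    · exact ⟨hB.2 h3, rfl⟩
  φ_zero := by
    rintro i ⟨a, b⟩ h
    dsimp only at h ⊢
    rw [if_neg (by omega), B.φ_zero i b (by omega)]
    rfl
  ε_zero := by
    rintro i ⟨a, b⟩ h
    dsimp only at h ⊢
    rw [if_pos (by omega), A.ε_zero i a (by omega)]
    rfl
  f_of_pos := by
    rintro i ⟨a, b⟩ h
    dsimp only at h ⊢
    split_ifs with h1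
    · obtain ⟨a', h'⟩ := A.f_of_pos i a (by omega)
      exact ⟨_, by rw [h']; rfl⟩
    · obtain ⟨b', h'⟩ := B.f_of_pos i b (by omega)
      exact ⟨_, by rw [h']; rfl⟩
  e_of_pos := by
    rintro i ⟨a, b⟩ h
    dsimp only at h ⊢
    split_ifs with h1
    · obtain ⟨a', h'⟩ := A.e_of_pos i a (by omega)
      exact ⟨_, by rw [h']; rfl⟩
    · obtain ⟨b', h'⟩ := B.e_of_pos i b (by omega)
      exact ⟨_, by rw [h']; rfl⟩
  φ_step := by
    rintro i ⟨a, b⟩ ⟨a', b'⟩ h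
    dsimp only at h ⊢
    split_ifs at h with h1 <;> simp only [map_mk_left_eq_some, map_mk_right_eq_some] at h <;>
      obtain ⟨h, rfl⟩ := h
    · have := A.φ_step _ _ _ h; omega
    · have := B.φ_step _ _ _ h
      have := B.ε_step _ _ _ h
      omega
  ε_step := by
    rintro i ⟨a, b⟩ ⟨a', b'⟩ h
    dsimp only at h ⊢
    split_ifs at h with h1 <;> simp only [map_mk_left_eq_some, map_mk_right_eq_some] at h <;>
      obtain ⟨h, rfl⟩ := h
    · have := A.φ_step _ _ _ h
      have := A.ε_step _ _ _ h
      omega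
    · have := B.ε_step _ _ _ h
      omega

section

variable {A : Crystal V} {B : Crystal W}

theorem tens_φ (i : ℕ) (a : V) (b : W) :
    (tens A B).φ i (a, b) = B.φ i b + (A.φ i a - B.ε i b) := rfl

theorem tens_ε (i : ℕ) (a : V) (b : W) :
    (tens A B).ε i (a, b) = A.ε i a + (B.ε i b - A.φ i a) := rfl

theorem tens_left {i : ℕ} {a a' : V} {b : W} (h : A.f i a = some a')
    (hlt : B.ε i b < A.φ i a) : (tens A B).f i (a, b) = some (a', b) := by
  simp [tens, hlt, h]

theorem tens_right {i : ℕ} {a : V} {b b' : W} (h : B.f i b = some b')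
    (hle : A.φ i a ≤ B.ε i b) : (tens A B).f i (a, b) = some (a, b') := by
  simp [tens, Nat.not_lt.2 hle, h]

theorem tens_f_cases {i : ℕ} {a : V} {b : W} {y : V × W} (h : (tens A B).f i (a, b) = some y) :
    (∃ a', y = (a', b) ∧ A.f i a = some a' ∧ B.ε i b < A.φ i a) ∨
      (∃ b', y = (a, b') ∧ B.f i b = some b' ∧ A.φ i a ≤ B.ε i b) := by
  simp only [tens] at h
  split_ifs at h with h1 <;> obtain ⟨c, hc, rfl⟩ := Option.map_eq_some_iff.1 h
  · exact .inl ⟨c, rfl, hc, h1⟩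
  · exact .inr ⟨c, rfl, hc, by omega⟩

/-- The two sides of a Verma octagon with initial edges ending in `v` and `v'`. -/
def Octagon (B : Crystal V) (i j : ℕ) (v v' : V) : Prop :=
  ∃ a b c d w, B.f j v = some a ∧ B.f j a = some b ∧ B.f i b = some w ∧
    B.f i v' = some c ∧ B.f i c = some d ∧ B.f j d = some w

theorem Octagon.symm {B : Crystal V} {i j : ℕ} {v v' : V} (h : Octagon B i j v v') :
    Octagon B j i v' v := by
  obtain ⟨a, b, c, d, w, h1, h2, h3, h4, h5, h6⟩ := h
  exact ⟨c, d, a, b, w, h4, h5, h6, h1, h2, h3⟩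

variable {i j : ℕ}

theorem tens_octagon_left_right (hA : Regular A i j) (hB : Regular B i j) {a a1 : V} {b b1 : W}
    (hi : A.f i a = some a1) (hj : B.f j b = some b1) (hpi : B.ε i b < A.φ i a)
    (hpj : A.φ j a = B.ε j b) (hl : A.φ j a1 = A.φ j a + 1) :
    Octagon (tens A B) i j (a1, b) (a, b1) := by
  obtain ⟨a2, ha2⟩ := A.f_of_pos j a1 (by omega)
  have l2 := hA.label_zero_of_one hi ha2 hl
  have s1 := A.φ_step _ _ _ hi
  have s2 := A.φ_step _ _ _ ha2
  have t1 := B.ε_step _ _ _ hj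
  have t2 := B.φ_step _ _ _ hj
  have m := hB.half'.wt _ _ hj
  rcases Nat.lt_or_ge (B.ε i b1) (A.φ i a1) with hp | hp
  · obtain ⟨a3, ha3⟩ := A.f_of_pos i a1 (by omega)
    have l3 := hA.half.conv _ _ _ hi ha3 hl
    obtain ⟨_, w, hw, hw'⟩ := hA.half'.sq _ _ _ ha2 ha3 l2.1
    exact ⟨(a2, b), (a2, b1), (a1, b1), (a3, b1), (w, b1), tens_left ha2 (by omega),
      tens_right hj (by omega), tens_left hw (by omega), tens_left hi (by omega),
      tens_left ha3 (by omega), tens_left hw' (by omega)⟩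
  · have hm : B.φ i b1 = B.φ i b + 1 := by omega
    obtain ⟨b2, hb2⟩ := B.f_of_pos i b1 (by omega)
    have l3 := hB.symm.label_zero_of_one hj hb2 hm
    exact ⟨(a2, b), (a2, b1), (a1, b1), (a1, b2), (a2, b2), tens_left ha2 (by omega),
      tens_right hj (by omega), tens_right hb2 (by omega), tens_left hi (by omega),
      tens_right hb2 (by omega), tens_left ha2 (by omega)⟩

theorem tens_octagon_right_right (hA : Regular A i j) (hB : Regular B i j) {a : V} {b b1 b2 : W}
    (hi : B.f i b = some b1) (hj : B.f j b = some b2) (hpi : A.φ i a ≤ B.ε i b)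
    (hpj : A.φ j a = B.ε j b) (hl : B.φ j b1 = B.φ j b) :
    Octagon (tens A B) i j (a, b1) (a, b2) := by
  obtain ⟨l2, w, hw, hw'⟩ := hB.half.sq _ _ _ hi hj hl
  have m := hB.half.wt _ _ hi
  have m' := hB.half'.wt _ _ hj
  have s1 := B.φ_step _ _ _ hi
  have s2 := B.φ_step _ _ _ hj
  have s3 := B.φ_step _ _ _ hw
  have s4 := B.φ_step _ _ _ hw'
  have t1 := B.ε_step _ _ _ hi
  have t2 := B.ε_step _ _ _ hj
  have t3 := B.ε_step _ _ _ hw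
  have t4 := B.ε_step _ _ _ hw'
  obtain ⟨a1, ha1⟩ := A.f_of_pos j a (by omega)
  have s5 := A.φ_step _ _ _ ha1
  have m3 := hA.half'.wt _ _ ha1
  obtain ⟨w1, hw1⟩ := B.f_of_pos i w (by omega)
  have l3 := hB.symm.label_zero_of_one hw hw1 (by omega)
  have t5 := B.ε_step _ _ _ hw1
  exact ⟨(a1, b1), (a1, w), (a, w), (a, w1), (a1, w1), tens_left ha1 (by omega),
    tens_right hw (by omega), tens_right hw1 (by omega), tens_right hw' (by omega),
    tens_right hw1 (by omega), tens_left ha1 (by omega)⟩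

theorem Half.tens (hA : Regular A i j) (hB : Regular B i j) : Half (tens A B) i j where
  wt := by
    rintro ⟨a, b⟩ v h
    rcases tens_f_cases h with ⟨a1, rfl, h1, h2⟩ | ⟨b1, rfl, h1, h2⟩ <;>
      simp only [tens_φ, tens_ε]
    · have := hA.half.wt _ _ h1; omega
    · have := hB.half.wt _ _ h1; omega
  conv := by
    rintro ⟨a, b⟩ v w h h' hl
    rcases tens_f_cases h with ⟨a1, rfl, h1, h2⟩ | ⟨b1, rfl, h1, h2⟩ <;>
      rcases tens_f_cases h' with ⟨a2, rfl, h3, h4⟩ | ⟨b2, rfl, h3, h4⟩ <;>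
      simp only [tens_φ] at hl ⊢
    · have := hA.half.wt _ _ h1
      have := hA.half.wt _ _ h3
      have := hA.half.conv _ _ _ h1 h3
      omega
    · have := hA.half.wt _ _ h1
      have := hB.half.wt _ _ h3
      omega
    · have := B.ε_step _ _ _ h1
      omega
    · have := hB.half.wt _ _ h1
      have := hB.half.wt _ _ h3
      have := hB.half.conv _ _ _ h1 h3
      omega
  sq := by
    rintro ⟨a, b⟩ v w h h' hl
    rcases tens_f_cases h with ⟨a1, rfl, h1, h2⟩ | ⟨b1, rfl, h1, h2⟩ <;>
      rcases tens_f_cases h' with ⟨a2, rfl, h3, h4⟩ | ⟨b2, rfl, h3, h4⟩ <;>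
      simp only [tens_φ] at hl ⊢
    · have := hA.half.wt _ _ h1
      have := hA.half'.wt _ _ h3
      obtain ⟨l, w, hw, hw'⟩ := hA.half.sq _ _ _ h1 h3 (by omega)
      exact ⟨by omega, (w, b), tens_left hw (by omega), tens_left hw' (by omega)⟩
    · have := hA.half.wt _ _ h1
      have := hB.half'.wt _ _ h3
      exact ⟨by omega, (a1, b2), tens_right h3 (by omega), tens_left h1 (by omega)⟩
    · have := hB.half.wt _ _ h1
      omega
    · have := hB.half.wt _ _ h1
      have := hB.half'.wt _ _ h3
      obtain ⟨l, w, hw, hw'⟩ := hB.half.sq _ _ _ h1 h3 (by omega)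
      exact ⟨by omega, (a, w), tens_right hw (by omega), tens_right hw' (by omega)⟩
  verma := by
    rintro ⟨a, b⟩ v w h h' hl hl'
    rcases tens_f_cases h with ⟨a1, rfl, h1, h2⟩ | ⟨b1, rfl, h1, h2⟩ <;>
      rcases tens_f_cases h' with ⟨a2, rfl, h3, h4⟩ | ⟨b2, rfl, h3, h4⟩ <;>
      simp only [tens_φ] at hl hl'
    · have := hA.half.wt _ _ h1
      have := hA.half'.wt _ _ h3
      have l : A.φ j a1 = A.φ j a + 1 := by omega
      have l' : A.φ i a2 = A.φ i a + 1 := by omega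
      obtain ⟨c1, c2, d1, d2, w, e1, e2, e3, e4, e5, e6⟩ := hA.half.verma _ _ _ h1 h3 l l'
      have m := hA.verma_labels h1 l l' e1 e2 e3 e4 e5 e6
      have m' := hA.symm.verma_labels h3 l' l e4 e5 e6 e1 e2 e3
      have := A.φ_step _ _ _ h1
      have := A.φ_step _ _ _ h3
      have := A.φ_step _ _ _ e1
      have := A.φ_step _ _ _ e4
      exact ⟨(c1, b), (c2, b), (d1, b), (d2, b), (w, b), tens_left e1 (by omega),
        tens_left e2 (by omega), tens_left e3 (by omega), tens_left e4 (by omega),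
        tens_left e5 (by omega), tens_left e6 (by omega)⟩
    · have := hA.half.wt _ _ h1
      exact tens_octagon_left_right hA hB h1 h3 h2 (by omega) (by omega)
    · have := hA.half'.wt _ _ h3
      exact (tens_octagon_left_right hA.symm hB.symm h3 h1 h4 (by omega) (by omega)).symm
    · have := hB.half.wt _ _ h1
      have := hB.half'.wt _ _ h3
      by_cases l : B.φ j b1 = B.φ j b
      · exact tens_octagon_right_right hA hB h1 h3 h2 (by omega) l
      by_cases l' : B.φ i b2 = B.φ i b
      · exact (tens_octagon_right_right hA.symm hB.symm h3 h1 h4 (by omega) l').symm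
      replace l : B.φ j b1 = B.φ j b + 1 := by omega
      replace l' : B.φ i b2 = B.φ i b + 1 := by omega
      obtain ⟨c1, c2, d1, d2, w, e1, e2, e3, e4, e5, e6⟩ := hB.half.verma _ _ _ h1 h3 l l'
      have m := hB.verma_labels h1 l l' e1 e2 e3 e4 e5 e6
      have m' := hB.symm.verma_labels h3 l' l e4 e5 e6 e1 e2 e3
      have := B.ε_step _ _ _ h1
      have := B.ε_step _ _ _ h3
      have := B.ε_step _ _ _ e1
      have := B.ε_step _ _ _ e4
      exact ⟨(a, c1), (a, c2), (a, d1), (a, d2), (a, w), tens_right e1 (by omega),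
        tens_right e2 (by omega), tens_right e3 (by omega), tens_right e4 (by omega),
        tens_right e5 (by omega), tens_right e6 (by omega)⟩

/-- Transport of the local axioms along a bijection compatible with the crystal structures. -/
theorem Half.comap {A : Crystal V} {B : Crystal W} (g : V → W) (hg : Function.Injective g)
    (hf : ∀ i u, B.f i (g u) = (A.f i u).map g) (hφ : ∀ i u, B.φ i (g u) = A.φ i u)
    (hε : ∀ i u, B.ε i (g u) = A.ε i u) (h : Half B i j) : Half A i j := by
  have step : ∀ {i u v}, A.f i u = some v → B.f i (g u) = some (g v) := by
    intro i u v h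
    simp [hf, h]
  have lift : ∀ {i u y}, B.f i (g u) = some y → ∃ v, y = g v ∧ A.f i u = some v := by
    intro i u y h
    rw [hf] at h
    obtain ⟨v, hv, rfl⟩ := Option.map_eq_some_iff.1 h
    exact ⟨v, rfl, hv⟩
  constructor
  · intro u v hu
    have := h.wt _ _ (step hu)
    simpa only [hφ, hε] using this
  · intro u v w hu hv
    have := h.conv _ _ _ (step hu) (step hv)
    simpa only [hφ] using this
  · intro u v v' hu hv hl
    obtain ⟨h1, w, h2, h3⟩ := h.sq _ _ _ (step hu) (step hv) (by simpa only [hφ] using hl)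
    obtain ⟨w', rfl, k2⟩ := lift h2
    obtain ⟨w'', e, k3⟩ := lift h3
    obtain rfl := hg e
    exact ⟨by simpa only [hφ] using h1, w', k2, k3⟩
  · intro u v v' hu hv hl hl'
    obtain ⟨a, b, c, d, w, h1, h2, h3, h4, h5, h6⟩ := h.verma _ _ _ (step hu) (step hv)
      (by simpa only [hφ] using hl) (by simpa only [hφ] using hl')
    obtain ⟨a, rfl, k1⟩ := lift h1
    obtain ⟨b, rfl, k2⟩ := lift h2
    obtain ⟨w, rfl, k3⟩ := lift h3
    obtain ⟨c, rfl, k4⟩ := lift h4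
    obtain ⟨d, rfl, k5⟩ := lift h5
    obtain ⟨w', e, k6⟩ := lift h6
    obtain rfl := hg e
    exact ⟨a, b, c, d, w, k1, k2, k3, k4, k5, k6⟩

theorem Half.tens_dual (hA : Regular A i j) (hB : Regular B i j) :
    Half (Crystal.tens A B).dual i j := by
  refine Half.comap (B := Crystal.tens B.dual A.dual) Prod.swap Prod.swap_injective ?_ ?_ ?_
    (Half.tens hB.dual hA.dual)
  · rintro i ⟨a, b⟩
    change (if A.φ i a < B.ε i b then (B.e i b).map (·, a) else (A.e i a).map (b, ·)) =
      (if B.ε i b ≤ A.φ i a then (A.e i a).map (·, b) else (B.e i b).map (a, ·)).map Prod.swap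
    split_ifs
    · omega
    · simp [Option.map_map, Function.comp_def]
    · simp [Option.map_map, Function.comp_def]
    · omega
  · rintro i ⟨a, b⟩
    rfl
  · rintro i ⟨a, b⟩
    rfl

theorem Regular.tens (hA : Regular A i j) (hB : Regular B i j) : Regular (tens A B) i j :=
  ⟨.tens hA hB, .tens hA.symm hB.symm, .tens_dual hA hB, .tens_dual hA.symm hB.symm⟩

theorem FarPair.tens (hA : FarPair A i j) (hA' : FarPair A j i) (hB : FarPair B i j)
    (hB' : FarPair B j i) : FarPair (tens A B) i j where
  wt := by
    rintro ⟨a, b⟩ v h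
    rcases tens_f_cases h with ⟨a1, rfl, h1, h2⟩ | ⟨b1, rfl, h1, h2⟩ <;>
      simp only [tens_φ, tens_ε]
    · have := hA.wt _ _ h1; omega
    · have := hB.wt _ _ h1; omega
  sq := by
    rintro ⟨a, b⟩ v w h h'
    rcases tens_f_cases h with ⟨a1, rfl, h1, h2⟩ | ⟨b1, rfl, h1, h2⟩ <;>
      rcases tens_f_cases h' with ⟨a2, rfl, h3, h4⟩ | ⟨b2, rfl, h3, h4⟩
    · have := hA.wt _ _ h1
      have := hA'.wt _ _ h3
      obtain ⟨w, hw, hw'⟩ := hA.sq _ _ _ h1 h3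
      exact ⟨(w, b), tens_left hw (by omega), tens_left hw' (by omega)⟩
    · have := hA.wt _ _ h1
      have := hB'.wt _ _ h3
      exact ⟨(a1, b2), tens_right h3 (by omega), tens_left h1 (by omega)⟩
    · have := hB.wt _ _ h1
      have := hA'.wt _ _ h3
      exact ⟨(a2, b1), tens_left h3 (by omega), tens_right h1 (by omega)⟩
    · have := hB.wt _ _ h1
      have := hB'.wt _ _ h3
      obtain ⟨w, hw, hw'⟩ := hB.sq _ _ _ h1 h3
      exact ⟨(a, w), tens_right hw (by omega), tens_right hw' (by omega)⟩
  dual_sq := by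
    rintro ⟨a, b⟩ v ⟨a', b'⟩ h h'
    rcases tens_f_cases h with ⟨a1, rfl, h1, h2⟩ | ⟨b1, rfl, h1, h2⟩ <;>
      rcases tens_f_cases h' with ⟨a2, e, h3, h4⟩ | ⟨b2, e, h3, h4⟩ <;>
      simp only [Prod.mk.injEq] at e <;> obtain ⟨rfl, rfl⟩ := e
    · obtain ⟨w, hw, hw'⟩ := hA.dual_sq _ _ _ h1 h3
      have := hA.wt _ _ hw'
      have := hA'.wt _ _ hw
      exact ⟨(w, b), tens_left hw (by omega), tens_left hw' (by omega)⟩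
    · have := hA.wt _ _ h1
      have := hB'.wt _ _ h3
      exact ⟨(a, b'), tens_right h3 (by omega), tens_left h1 (by omega)⟩
    · have := hB.wt _ _ h1
      have := hA'.wt _ _ h3
      exact ⟨(a', b), tens_left h3 (by omega), tens_right h1 (by omega)⟩
    · obtain ⟨w, hw, hw'⟩ := hB.dual_sq _ _ _ h1 h3
      have := hB.wt _ _ hw'
      have := hB'.wt _ _ hw
      exact ⟨(a, w), tens_right hw (by omega), tens_right hw' (by omega)⟩

end

theorem Far.symm {i j : ℕ} (h : Far i j) : Far j i := Or.symm h

theorem IsRegular.tens {A : Crystal V} {B : Crystal W} (hA : A.IsRegular) (hB : B.IsRegular) :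
    (tens A B).IsRegular where
  color := by
    rintro i ⟨a, b⟩ v h
    rcases tens_f_cases h with ⟨a1, rfl, h1, h2⟩ | ⟨b1, rfl, h1, h2⟩
    · exact hA.color _ _ _ h1
    · exact hB.color _ _ _ h1
  near i j h1 h2 h3 h4 h := (hA.near i j h1 h2 h3 h4 h).tens (hB.near i j h1 h2 h3 h4 h)
  far i j h1 h2 h3 h4 h := .tens (hA.far i j h1 h2 h3 h4 h) (hA.far j i h3 h4 h1 h2 (Far.symm h))
    (hB.far i j h1 h2 h3 h4 h) (hB.far j i h3 h4 h1 h2 (Far.symm h))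

/-- The one-vertex crystal. -/
def trivialCrystal : Crystal Unit where
  f _ _ := none
  e _ _ := none
  φ _ _ := 0
  ε _ _ := 0
  f_iff_e := by simp
  φ_zero := by simp
  ε_zero := by simp
  f_of_pos := by simp
  e_of_pos := by simp
  φ_step := by simp
  ε_step := by simp

theorem trivialCrystal_half (i j : ℕ) : Half trivialCrystal i j := by
  constructor <;> simp [trivialCrystal]

theorem trivialCrystal_isRegular : trivialCrystal.IsRegular where
  color := by simp [trivialCrystal]
  near i j _ _ _ _ _ := ⟨trivialCrystal_half i j, trivialCrystal_half j i,
    trivialCrystal_half i j, trivialCrystal_half j i⟩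
  far i j _ _ _ _ _ := by constructor <;> simp [trivialCrystal]

/-- Words of length `n` with letters in `V`, as iterated pairs. -/
def Pow (V : Type) : ℕ → Type
  | 0 => Unit
  | n + 1 => V × Pow V n

/-- The `n`-th tensor power of a crystal. -/
def pow (A : Crystal V) : (n : ℕ) → Crystal (Pow V n)
  | 0 => trivialCrystal
  | n + 1 => Crystal.tens A (pow A n)

theorem IsRegular.pow {A : Crystal V} (hA : A.IsRegular) : ∀ n, (pow A n).IsRegular
  | 0 => trivialCrystal_isRegular
  | n + 1 => hA.tens (IsRegular.pow hA n)

end Crystal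

/-- Letters: the pair `(a, b)` with `a ≠ b` stands for the root `ε_a - ε_b` of type `A_4`; four
of the diagonal pairs stand for the zero weights, and `(2, 2)` for a trivial summand. -/
abbrev Letter := Fin 5 × Fin 5

/-- The arrows of one color in the adjoint crystal: `(k, l) → h → (l, k)`, and `k → l` in the
first coordinate or `l → k` in the second one. -/
def rootStep (k l : Fin 5) (h p : Letter) : Option Letter :=
  if p = (k, l) then some h
  else if p = h then some (l, k)
  else if p.1 = k ∧ p.2 ≠ k ∧ p.2 ≠ l then some (l, p.2)
  else if p.2 = l ∧ p.1 ≠ k ∧ p.1 ≠ l then some (p.1, k)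
  else none

def letterF : ℕ → Letter → Option Letter
  | 1 => rootStep 0 1 (0, 0)
  | 2 => rootStep 1 2 (1, 1)
  | 3 => rootStep 2 3 (3, 3)
  | 4 => rootStep 3 4 (4, 4)
  | _ => fun _ => none

def letterE : ℕ → Letter → Option Letter
  | 1 => rootStep 1 0 (0, 0)
  | 2 => rootStep 2 1 (1, 1)
  | 3 => rootStep 3 2 (3, 3)
  | 4 => rootStep 4 3 (4, 4)
  | _ => fun _ => none

/-- Length of a string with at most two arrows. -/
def runLength (f : Letter → Option Letter) (p : Letter) : ℕ :=
  match f p with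
  | none => 0
  | some q => if (f q).isSome then 2 else 1

theorem letter_color_cases (i : ℕ) : (i = 1 ∨ i = 2 ∨ i = 3 ∨ i = 4) ∨
    (letterF i = fun _ => none) ∧ (letterE i = fun _ => none) := by
  rcases i with _ | _ | _ | _ | _ | i
  · exact .inr ⟨rfl, rfl⟩
  · simp
  · simp
  · simp
  · simp
  · exact .inr ⟨rfl, rfl⟩

theorem letter_arrows : ∀ i ∈ [1, 2, 3, 4], ∀ a b : Fin 5,
    (∀ v ∈ letterF i (a, b), letterE i v = some (a, b) ∧
      runLength (letterF i) (a, b) = runLength (letterF i) v + 1 ∧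
      runLength (letterE i) v = runLength (letterE i) (a, b) + 1) ∧
    (∀ v ∈ letterE i (a, b), letterF i v = some (a, b)) := by
  decide

def letterCrystal : Crystal Letter where
  f := letterF
  e := letterE
  φ i := runLength (letterF i)
  ε i := runLength (letterE i)
  f_iff_e i u v := by
    rcases letter_color_cases i with hi | ⟨h, h'⟩
    · have hi : i ∈ [1, 2, 3, 4] := by simpa using hi
      exact ⟨fun h => ((letter_arrows i hi u.1 u.2).1 v h).1,
        fun h => (letter_arrows i hi v.1 v.2).2 u h⟩
    · simp [h, h']
  φ_zero i u h := by
    unfold runLength at h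
    split at h
    · assumption
    · split_ifs at h
  ε_zero i u h := by
    unfold runLength at h
    split at h
    · assumption
    · split_ifs at h
  f_of_pos i u h := by
    unfold runLength at h
    split at h
    · omega
    · exact ⟨_, by assumption⟩
  e_of_pos i u h := by
    unfold runLength at h
    split at h
    · omega
    · exact ⟨_, by assumption⟩
  φ_step i u v h := by
    rcases letter_color_cases i with hi | ⟨h', _⟩
    · exact ((letter_arrows i (by simpa using hi) u.1 u.2).1 v h).2.1
    · simp [h'] at h
  ε_step i u v h := by
    rcases letter_color_cases i with hi | ⟨hnone, _⟩
    · exact ((letter_arrows i (by simpa using hi) u.1 u.2).1 v h).2.2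
    · simp [hnone] at h

/-- A decidable form of the local axioms for neighbouring colors. -/
def LetterSquare (f e : ℕ → Letter → Option Letter) (i j : ℕ) : Prop :=
  ∀ a b : Fin 5, ∀ v ∈ f i (a, b),
    ((runLength (f j) v = runLength (f j) (a, b) + 1 ∧ runLength (e j) v = runLength (e j) (a, b)) ∨
      (runLength (f j) v = runLength (f j) (a, b) ∧
        runLength (e j) (a, b) = runLength (e j) v + 1)) ∧
    (∀ w ∈ f i v, runLength (f j) v = runLength (f j) (a, b) + 1 →
      runLength (f j) w = runLength (f j) v + 1) ∧
    (∀ v' ∈ f j (a, b), runLength (f j) v = runLength (f j) (a, b) →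
        runLength (f i) v' = runLength (f i) (a, b) + 1 ∧ ∃ w ∈ f j v, f i v' = some w)

/-- A decidable form of the Verma relations. -/
def LetterVerma (f : ℕ → Letter → Option Letter) (i j : ℕ) : Prop :=
  ∀ a b : Fin 5, ∀ v ∈ f i (a, b), ∀ v' ∈ f j (a, b),
    runLength (f j) v = runLength (f j) (a, b) + 1 →
    runLength (f i) v' = runLength (f i) (a, b) + 1 →
      (((f j v).bind (f j)).bind (f i)).isSome ∧
        ((f j v).bind (f j)).bind (f i) = ((f i v').bind (f i)).bind (f j)

set_option synthInstance.maxSize 4096 in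
set_option synthInstance.maxHeartbeats 400000 in
theorem letterSquare : ∀ p ∈ [(1, 2), (2, 1), (2, 3), (3, 2), (3, 4), (4, 3)],
    LetterSquare letterF letterE p.1 p.2 ∧ LetterSquare letterE letterF p.1 p.2 := by
  unfold LetterSquare
  decide

set_option synthInstance.maxSize 4096 in
set_option synthInstance.maxHeartbeats 400000 in
theorem letterVerma : ∀ p ∈ [(1, 2), (2, 1), (2, 3), (3, 2), (3, 4), (4, 3)],
    LetterVerma letterF p.1 p.2 ∧ LetterVerma letterE p.1 p.2 := by
  unfold LetterVerma
  decide

theorem letterFar : ∀ p ∈ [(1, 3), (3, 1), (2, 4), (4, 2), (1, 4), (4, 1)], ∀ a b : Fin 5,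
    ∀ v ∈ letterF p.1 (a, b),
      (runLength (letterF p.2) v = runLength (letterF p.2) (a, b) ∧
        runLength (letterE p.2) v = runLength (letterE p.2) (a, b)) ∧
      (∀ v' ∈ letterF p.2 (a, b), ∃ w ∈ letterF p.2 v, letterF p.1 v' = some w) ∧
      (∀ v' ∈ letterE p.2 v, ∃ w ∈ letterE p.2 (a, b), letterF p.1 w = some v') := by
  decide

theorem letterCrystal_half {i j : ℕ} (hi : 1 ≤ i) (hi' : i ≤ 4) (hj : 1 ≤ j) (hj' : j ≤ 4)
    (h : Neighb i j) :
    Crystal.Half letterCrystal i j ∧ Crystal.Half letterCrystal.dual i j := by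
  have key : ∀ (B : Crystal Letter) {f e : ℕ → Letter → Option Letter} {i j : ℕ}, B.f = f →
      (∀ i, B.φ i = runLength (f i)) → (∀ i, B.ε i = runLength (e i)) → LetterSquare f e i j →
      LetterVerma f i j → Crystal.Half B i j := by
    rintro B f e i j rfl hφ hε hs hv
    refine ⟨?_, ?_, ?_, ?_⟩
    · intro u v hu
      rw [hφ, hε]
      exact (hs u.1 u.2 v hu).1
    · intro u v w hu hw
      rw [hφ]
      exact (hs u.1 u.2 v hu).2.1 w hw
    · intro u v v' hu hu'
      rw [hφ, hφ]
      exact (hs u.1 u.2 v hu).2.2 v' hu'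
    · intro u v v' hu hu'
      rw [hφ, hφ]
      intro hl hl'
      obtain ⟨h1, h2⟩ := hv u.1 u.2 v hu v' hu' hl hl'
      obtain ⟨w, hw⟩ := Option.isSome_iff_exists.1 h1
      rw [hw] at h2
      simp only [Option.bind_eq_some_iff] at hw
      obtain ⟨y, ⟨x, hx, hy⟩, hw⟩ := hw
      obtain ⟨t, ⟨z, hz, ht⟩, hw'⟩ : ∃ t, (∃ z, B.f i v' = some z ∧ B.f i z = some t) ∧
          B.f j t = some w := by
        simpa only [Option.bind_eq_some_iff] using h2.symm
      exact ⟨x, y, z, t, w, hx, hy, hw, hz, ht, hw'⟩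
  have hmem : (i, j) ∈ [(1, 2), (2, 1), (2, 3), (3, 2), (3, 4), (4, 3)] := by
    unfold Neighb at h
    interval_cases i <;> interval_cases j <;> simp at h ⊢
  have h1 := letterSquare _ hmem
  have h2 := letterVerma _ hmem
  exact ⟨key letterCrystal rfl (fun _ => rfl) (fun _ => rfl) h1.1 h2.1,
    key letterCrystal.dual rfl (fun _ => rfl) (fun _ => rfl) h1.2 h2.2⟩

theorem Neighb.symm {i j : ℕ} (h : Neighb i j) : Neighb j i := Or.symm h

theorem letterCrystal_isRegular : letterCrystal.IsRegular where
  color i u v h := by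
    rcases letter_color_cases i with hi | ⟨h', _⟩
    · omega
    · exact absurd h (by simp [letterCrystal, h'])
  near i j h1 h2 h3 h4 h :=
    ⟨(letterCrystal_half h1 h2 h3 h4 h).1, (letterCrystal_half h3 h4 h1 h2 h.symm).1,
      (letterCrystal_half h1 h2 h3 h4 h).2, (letterCrystal_half h3 h4 h1 h2 h.symm).2⟩
  far i j h1 h2 h3 h4 h := by
    have hmem : (i, j) ∈ [(1, 3), (3, 1), (2, 4), (4, 2), (1, 4), (4, 1)] := by
      unfold Far at h
      interval_cases i <;> interval_cases j <;> simp at h ⊢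
    have key := letterFar _ hmem
    refine ⟨fun u v hu => (key u.1 u.2 v hu).1, ?_, ?_⟩
    · intro u v v' hu hu'
      exact (key u.1 u.2 v hu).2.1 v' hu'
    · intro u v v' hu hu'
      obtain ⟨w, hw, hw'⟩ :=
        (key u.1 u.2 v hu).2.2 v' ((letterCrystal.f_iff_e _ _ _).1 hu')
      exact ⟨w, (letterCrystal.f_iff_e _ _ _).2 hw, hw'⟩

namespace Crystal

variable {V : Type}

/-- The composite operator attached to the pair of colors `1, 4` or `2, 3`. -/
def chain (B : Crystal V) (i : ℕ) (u : V) : Option V :=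
  if i = 1 then (B.f 1 u).bind (B.f 4)
  else if i = 2 then (((B.f 2 u).bind (B.f 3)).bind (B.f 3)).bind (B.f 2)
  else none

theorem chain_one_eq_some {B : Crystal V} {u w : V} :
    B.chain 1 u = some w ↔ ∃ x, B.f 1 u = some x ∧ B.f 4 x = some w := by
  simp [chain, Option.bind_eq_some_iff]

theorem chain_two_eq_some {B : Crystal V} {u w : V} :
    B.chain 2 u = some w ↔ ∃ x y z, B.f 2 u = some x ∧ B.f 3 x = some y ∧ B.f 3 y = some z ∧
      B.f 2 z = some w := by
  rw [show B.chain 2 u = (((B.f 2 u).bind (B.f 3)).bind (B.f 3)).bind (B.f 2) from rfl]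
  simp only [Option.bind_eq_some_iff]
  constructor
  · rintro ⟨z, ⟨y, ⟨x, h1, h2⟩, h3⟩, h4⟩
    exact ⟨x, y, z, h1, h2, h3, h4⟩
  · rintro ⟨x, y, z, h1, h2, h3, h4⟩
    exact ⟨z, ⟨y, ⟨x, h1, h2⟩, h3⟩, h4⟩

/-- A map reversing the order of the colors. -/
structure Reverses (B : Crystal V) (σ : V → V) : Prop where
  f_eq : ∀ i u, B.f (5 - i) (σ u) = (B.f i u).map σ
  φ_eq : ∀ i u, 1 ≤ i → i ≤ 4 → B.φ (5 - i) (σ u) = B.φ i u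
  ε_eq : ∀ i u, 1 ≤ i → i ≤ 4 → B.ε (5 - i) (σ u) = B.ε i u

section Symmetric

variable {B : Crystal V} {σ : V → V} {u : V}

theorem Reverses.φ_fixed (h : B.Reverses σ) (hu : σ u = u) {i : ℕ} (h1 : 1 ≤ i) (h4 : i ≤ 4) :
    B.φ (5 - i) u = B.φ i u := by
  conv_lhs => rw [← hu]
  exact h.φ_eq i u h1 h4

theorem Reverses.ε_fixed (h : B.Reverses σ) (hu : σ u = u) {i : ℕ} (h1 : 1 ≤ i) (h4 : i ≤ 4) :
    B.ε (5 - i) u = B.ε i u := by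
  conv_lhs => rw [← hu]
  exact h.ε_eq i u h1 h4

/-- At a fixed vertex, a `2`-edge starts one side of a Verma octagon. -/
theorem Reverses.exists_octagon (hB : B.IsRegular) (h : B.Reverses σ) (hu : σ u = u) {x : V}
    (hx : B.f 2 u = some x) : ∃ y z w, B.f 3 x = some y ∧ B.f 3 y = some z ∧
      B.f 2 z = some w ∧ B.ε 3 x = B.ε 3 u ∧ B.ε 2 z = B.ε 2 u := by
  have hR := hB.near 2 3 (by omega) (by omega) (by omega) (by omega) (.inl rfl)
  have hx' : B.f 3 u = some (σ x) := by
    have := h.f_eq 2 u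
    rw [hu, hx] at this
    exact this
  have e1 : B.φ 3 u = B.φ 2 u := h.φ_fixed (i := 2) hu (by omega) (by omega)
  have e2 : B.φ 2 (σ x) = B.φ 3 x := h.φ_eq 3 x (by omega) (by omega)
  have m := hR.half.wt _ _ hx
  have l : B.φ 3 x = B.φ 3 u + 1 := by
    by_contra hne
    have := (hR.half.sq _ _ _ hx hx' (by omega)).1
    omega
  obtain ⟨a, b, c, d, w, h1, h2, h3, h4, h5, h6⟩ := hR.half.verma _ _ _ hx hx' l (by omega)
  have m' := hR.verma_labels hx l (by omega) h1 h2 h3 h4 h5 h6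
  have := B.ε_step _ _ _ hx
  exact ⟨a, b, w, h1, h2, h3, by omega, by omega⟩

end Symmetric

end Crystal

open Crystal

/-- The color-reversing involution of the letters. -/
def letterRev (p : Letter) : Letter := (p.2.rev, p.1.rev)

theorem letterRev_f : ∀ i ∈ [1, 2, 3, 4], ∀ a b : Fin 5,
    letterF (5 - i) (letterRev (a, b)) = (letterF i (a, b)).map letterRev ∧
    runLength (letterF (5 - i)) (letterRev (a, b)) = runLength (letterF i) (a, b) ∧
    runLength (letterE (5 - i)) (letterRev (a, b)) = runLength (letterE i) (a, b) := by
  decide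

theorem letterCrystal_reverses : letterCrystal.Reverses letterRev where
  f_eq i u := by
    rcases i with _ | _ | _ | _ | _ | i
    · rfl
    · exact (letterRev_f 1 (by simp) u.1 u.2).1
    · exact (letterRev_f 2 (by simp) u.1 u.2).1
    · exact (letterRev_f 3 (by simp) u.1 u.2).1
    · exact (letterRev_f 4 (by simp) u.1 u.2).1
    · rw [show 5 - (i + 1 + 1 + 1 + 1 + 1) = 0 by omega]
      rfl
  φ_eq i u h1 h2 := (letterRev_f i (by simp; omega) u.1 u.2).2.1
  ε_eq i u h1 h2 := (letterRev_f i (by simp; omega) u.1 u.2).2.2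

/-- The color-reversing involution of words. -/
def powRev : (n : ℕ) → Pow Letter n → Pow Letter n
  | 0, u => u
  | n + 1, u => (letterRev u.1, powRev n u.2)

theorem Crystal.Reverses.tens {V W : Type} {A : Crystal V} {B : Crystal W} {σ : V → V} {τ : W → W}
    (hA : A.Reverses σ) (hB : B.Reverses τ) (hAr : A.IsRegular) (hBr : B.IsRegular) :
    (Crystal.tens A B).Reverses (Prod.map σ τ) where
  f_eq := by
    rintro i ⟨a, b⟩
    by_cases hi : 1 ≤ i ∧ i ≤ 4
    · have e1 := hA.φ_eq i a hi.1 hi.2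
      have e2 := hB.ε_eq i b hi.1 hi.2
      simp only [Crystal.tens, Prod.map, e1, e2, hA.f_eq, hB.f_eq]
      split_ifs <;> simp [Option.map_map, Function.comp_def]
    · have hn : ∀ j x, ¬(1 ≤ j ∧ j ≤ 4) → (Crystal.tens A B).f j x = none := by
        intro j x hj
        cases h : (Crystal.tens A B).f j x with
        | none => rfl
        | some y => exact absurd ((hAr.tens hBr).color _ _ _ h) hj
      rw [hn _ _ hi, hn _ _ (by omega)]
      rfl
  φ_eq := by
    rintro i ⟨a, b⟩ h1 h4
    simp only [Crystal.tens, Prod.map, hA.φ_eq i a h1 h4, hB.φ_eq i b h1 h4, hB.ε_eq i b h1 h4]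
  ε_eq := by
    rintro i ⟨a, b⟩ h1 h4
    simp only [Crystal.tens, Prod.map, hA.φ_eq i a h1 h4, hA.ε_eq i a h1 h4, hB.ε_eq i b h1 h4]

theorem pow_reverses : ∀ n, (Crystal.pow letterCrystal n).Reverses (powRev n)
  | 0 => ⟨fun _ _ => rfl, fun _ _ _ _ => rfl, fun _ _ _ _ => rfl⟩
  | n + 1 => letterCrystal_reverses.tens (pow_reverses n) letterCrystal_isRegular
      (letterCrystal_isRegular.pow n)

/-! ### Words in the fixed letters -/

/-- String lengths of the fixed letters. -/
def fixφ : ℕ → Fin 5 → ℕ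
  | 1, 0 => 1
  | 1, 3 => 1
  | 2, 1 => 1
  | _, _ => 0

def fixε : ℕ → Fin 5 → ℕ
  | 1, 1 => 1
  | 1, 4 => 1
  | 2, 3 => 1
  | _, _ => 0

def fixF : ℕ → Fin 5 → Option (Fin 5)
  | 1, 0 => some 1
  | 1, 3 => some 4
  | 2, 1 => some 3
  | _, _ => none

def barφε (i : ℕ) : List (Fin 5) → ℕ × ℕ
  | [] => (0, 0)
  | a :: l => ((barφε i l).1 + (fixφ i a - (barφε i l).2), fixε i a + ((barφε i l).2 - fixφ i a))

/-- Length of the outgoing string of a word in the fixed letters. -/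
def barφ (i : ℕ) (l : List (Fin 5)) : ℕ := (barφε i l).1

/-- Length of the incoming string of a word in the fixed letters. -/
def barε (i : ℕ) (l : List (Fin 5)) : ℕ := (barφε i l).2

/-- The operators on words in the fixed letters. -/
def barF (i : ℕ) : List (Fin 5) → Option (List (Fin 5))
  | [] => none
  | a :: l => if barε i l < fixφ i a then (fixF i a).map (· :: l) else (barF i l).map (a :: ·)

theorem barφ_cons (i : ℕ) (a : Fin 5) (l : List (Fin 5)) :
    barφ i (a :: l) = barφ i l + (fixφ i a - barε i l) := rfl

theorem barε_cons (i : ℕ) (a : Fin 5) (l : List (Fin 5)) :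
    barε i (a :: l) = fixε i a + (barε i l - fixφ i a) := rfl

theorem fix_arrows : ∀ i ∈ [1, 2], ∀ a : Fin 5,
    fixφ i a + fixε i a ≤ 1 ∧
    (∀ b ∈ fixF i a, fixφ i a = 1 ∧ fixε i b = 1) ∧
    (0 < fixφ i a → ∃ b ∈ fixF i a, 0 < fixε i b) ∧
    (0 < fixε i a → ∃ b, fixF i b = some a ∧ 0 < fixφ i b) := by
  decide

theorem barF_length {i : ℕ} {l l' : List (Fin 5)} (h : barF i l = some l') :
    l'.length = l.length := by
  induction l generalizing l' with
  | nil => simp [barF] at h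
  | cons a l ih =>
    simp only [barF] at h
    split_ifs at h <;> obtain ⟨c, hc, rfl⟩ := Option.map_eq_some_iff.1 h
    · rfl
    · simp [ih hc]

theorem barε_step {i : ℕ} (hi : i ∈ [1, 2]) {l l' : List (Fin 5)} (h : barF i l = some l') :
    barε i l' = barε i l + 1 := by
  induction l generalizing l' with
  | nil => simp [barF] at h
  | cons a l ih =>
    simp only [barF] at h
    split_ifs at h with hlt <;> obtain ⟨c, hc, rfl⟩ := Option.map_eq_some_iff.1 h
    · have := (fix_arrows i hi a).2.1 c hc
      have := (fix_arrows i hi c).1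
      have := (fix_arrows i hi a).1
      simp only [barε_cons]
      omega
    · have := ih hc
      simp only [barε_cons]
      omega

theorem exists_barF_of_barε_pos {i : ℕ} (hi : i ∈ [1, 2]) {l : List (Fin 5)} (h : 0 < barε i l) :
    ∃ l', barF i l' = some l := by
  induction l with
  | nil => simp [barε, barφε] at h
  | cons a l ih =>
    rw [barε_cons] at h
    have h0 := (fix_arrows i hi a).1
    by_cases hlt : fixφ i a < barε i l
    · obtain ⟨l', hl'⟩ := ih (by omega)
      have := barε_step hi hl'
      refine ⟨a :: l', ?_⟩
      simp only [barF]
      rw [if_neg (by omega), hl']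
      rfl
    · obtain ⟨b, hb, hb'⟩ := (fix_arrows i hi a).2.2.2 (by omega)
      refine ⟨b :: l, ?_⟩
      simp only [barF]
      rw [if_pos (by omega), hb]
      rfl

/-- The fixed letters of `letterRev`. -/
def fixedLetter (a : Fin 5) : Letter := (a, a.rev)

/-- The symmetric word of length `n` attached to a list of fixed letters. -/
def embedWord : (n : ℕ) → List (Fin 5) → Pow Letter n
  | 0, _ => ()
  | n + 1, [] => (fixedLetter 2, embedWord n [])
  | n + 1, a :: l => (fixedLetter a, embedWord n l)

theorem embedWord_injective {n : ℕ} {l l' : List (Fin 5)} (hl : l.length = n) (hl' : l'.length = n)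
    (h : embedWord n l = embedWord n l') : l = l' := by
  induction n generalizing l l' with
  | zero => rw [List.length_eq_zero_iff.1 hl, List.length_eq_zero_iff.1 hl']
  | succ n ih =>
    obtain ⟨a, l, rfl⟩ := List.exists_cons_of_length_eq_add_one hl
    obtain ⟨a', l', rfl⟩ := List.exists_cons_of_length_eq_add_one hl'
    obtain ⟨h1, h2⟩ := Prod.mk.inj h
    rw [(Prod.mk.inj h1).1, ih (by simpa using hl) (by simpa using hl') h2]

theorem exists_embedWord {n : ℕ} {u : Pow Letter n} (h : powRev n u = u) :
    ∃ l, l.length = n ∧ u = embedWord n l := by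
  induction n with
  | zero => exact ⟨[], rfl, rfl⟩
  | succ n ih =>
    obtain ⟨⟨a, b⟩, u⟩ := u
    obtain ⟨h1, h2⟩ := Prod.mk.inj h
    obtain ⟨l, hl, rfl⟩ := ih h2
    refine ⟨a :: l, by simp [hl], ?_⟩
    obtain ⟨h3, h4⟩ := Prod.mk.inj h1
    simp only at h4
    rw [← h4]
    rfl

theorem powRev_embedWord (n : ℕ) (l : List (Fin 5)) : powRev n (embedWord n l) = embedWord n l := by
  induction n generalizing l with
  | zero => rfl
  | succ n ih =>
    cases l <;> simp [powRev, embedWord, ih, letterRev, fixedLetter] <;> rfl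

theorem fixedLetter_lengths : ∀ i ∈ [1, 2], ∀ a : Fin 5,
    runLength (letterF i) (fixedLetter a) = fixφ i a ∧
    runLength (letterE i) (fixedLetter a) = fixε i a := by
  decide

theorem embedWord_lengths {i : ℕ} (hi : i ∈ [1, 2]) {n : ℕ} {l : List (Fin 5)} (hl : l.length = n) :
    (Crystal.pow letterCrystal n).φ i (embedWord n l) = barφ i l ∧
      (Crystal.pow letterCrystal n).ε i (embedWord n l) = barε i l := by
  induction n generalizing l with
  | zero =>
    rw [List.length_eq_zero_iff.1 hl]
    exact ⟨rfl, rfl⟩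
  | succ n ih =>
    obtain ⟨a, l, rfl⟩ := List.exists_cons_of_length_eq_add_one hl
    obtain ⟨h1, h2⟩ := ih (l := l) (by simpa using hl)
    obtain ⟨h3, h4⟩ := fixedLetter_lengths i hi a
    simp only [Crystal.pow, embedWord, tens_φ, tens_ε, h1, h2, barφ_cons, barε_cons]
    simp only [letterCrystal, h3, h4, true_and]

theorem letter_chain_one : ∀ a : Fin 5, 0 < fixφ 1 a → ∃ x ∈ letterF 1 (fixedLetter a),
    ∃ y ∈ letterF 4 x, 0 < runLength (letterF 4) x ∧ (fixF 1 a).map fixedLetter = some y := by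
  decide

theorem letter_chain_two : ∀ a : Fin 5, 0 < fixφ 2 a → ∃ x ∈ letterF 2 (fixedLetter a),
    ∃ y ∈ letterF 3 x, ∃ z ∈ letterF 3 y, ∃ w ∈ letterF 2 z,
      0 < runLength (letterF 3) x ∧ 0 < runLength (letterF 3) y ∧ 0 < runLength (letterF 2) z ∧
      (fixF 2 a).map fixedLetter = some w := by
  decide

/-- A prefixed letter that is not active does not interfere with `chain`. -/
theorem chain_tens_right {i n : ℕ} (hi : i ∈ [1, 2]) {a : Fin 5} {u : Pow Letter n}
    (hu : powRev n u = u)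
    (h : fixφ i a ≤ (Crystal.pow letterCrystal n).ε i u) :
    (Crystal.pow letterCrystal (n + 1)).chain i (fixedLetter a, u) =
      ((Crystal.pow letterCrystal n).chain i u).map (fixedLetter a, ·) := by
  have hR := letterCrystal_isRegular.pow n
  have hrev := pow_reverses n
  have hl := (fixedLetter_lengths i hi a).1
  have hrl : letterRev (fixedLetter a) = fixedLetter a := by simp [letterRev, fixedLetter]
  set B := Crystal.pow letterCrystal n with hB
  change (Crystal.tens letterCrystal B).chain i (fixedLetter a, u) = _
  have hφ : letterCrystal.φ i (fixedLetter a) = fixφ i a := hl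
  have hfr : (Crystal.tens letterCrystal B).f i (fixedLetter a, u) =
      (B.f i u).map (fixedLetter a, ·) := by
    simp only [Crystal.tens]
    rw [if_neg (by omega)]
  simp only [List.mem_cons, List.not_mem_nil, or_false] at hi
  cases hx : B.f i u with
  | none =>
    rw [hx] at hfr
    rcases hi with rfl | rfl <;> simp [chain, hfr, hx]
  | some x =>
    rw [hx] at hfr
    rcases hi with rfl | rfl
    · have e1 := letterCrystal_reverses.φ_fixed hrl (i := 1) (by omega) (by omega)
      have e2 := hrev.ε_fixed hu (i := 1) (by omega) (by omega)
      have e3 := (hR.far 1 4 (by omega) (by omega) (by omega) (by omega) (.inl (by omega))).wt _ _ hx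
      simp only [Nat.add_one_sub_one] at e1 e2
      simp only [chain, if_true, hfr, hx, Option.map_some, Option.bind_some]
      simp only [Crystal.tens]
      rw [if_neg (by omega)]
    · have e1 := letterCrystal_reverses.φ_fixed hrl (i := 2) (by omega) (by omega)
      have e2 := hrev.ε_fixed hu (i := 2) (by omega) (by omega)
      obtain ⟨y, z, w, h1, h2, h3, h4, h5⟩ := hrev.exists_octagon hR hu hx
      simp only [Nat.reduceSub] at e1 e2
      have s := B.ε_step _ _ _ h1
      rw [chain_two_eq_some.2 ⟨x, y, z, hx, h1, h2, h3⟩]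
      exact chain_two_eq_some.2 ⟨(fixedLetter a, x), (fixedLetter a, y), (fixedLetter a, z), hfr,
        tens_right h1 (by omega), tens_right h2 (by omega), tens_right h3 (by omega)⟩

theorem chain_embedWord {i : ℕ} (hi : i ∈ [1, 2]) {n : ℕ} {l : List (Fin 5)} (hl : l.length = n) :
    (Crystal.pow letterCrystal n).chain i (embedWord n l) = (barF i l).map (embedWord n) := by
  induction n generalizing l with
  | zero =>
    rw [List.length_eq_zero_iff.1 hl]
    simp only [List.mem_cons, List.not_mem_nil, or_false] at hi
    rcases hi with rfl | rfl <;> rfl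
  | succ n ih =>
    obtain ⟨a, l, rfl⟩ := List.exists_cons_of_length_eq_add_one hl
    have hl' : l.length = n := by simpa using hl
    have hε := (embedWord_lengths hi hl').2
    have hu := powRev_embedWord n l
    by_cases hlt : barε i l < fixφ i a
    · have hε' := (pow_reverses n).ε_fixed hu (i := i) (by simp at hi; omega) (by simp at hi; omega)
      simp only [barF, if_pos hlt]
      have h0 := (fix_arrows i hi a).1
      simp only [List.mem_cons, List.not_mem_nil, or_false] at hi
      rcases hi with rfl | rfl
      · obtain ⟨x, hx, y, hy, h1, h2⟩ := letter_chain_one a (by omega)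
        obtain ⟨b, hb, rfl⟩ := Option.map_eq_some_iff.1 h2
        rw [hb]
        simp only [Nat.reduceSub] at hε'
        have h3 : letterCrystal.φ 1 (fixedLetter a) = fixφ 1 a :=
          (fixedLetter_lengths 1 (by simp) a).1
        change 0 < letterCrystal.φ 4 x at h1
        exact chain_one_eq_some.2 ⟨(x, embedWord n l),
          tens_left (A := letterCrystal) hx (by omega),
          tens_left (A := letterCrystal) hy (by omega)⟩
      · obtain ⟨x, hx, y, hy, z, hz, w, hw, h1, h2, h3, h4⟩ := letter_chain_two a (by omega)
        obtain ⟨b, hb, rfl⟩ := Option.map_eq_some_iff.1 h4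
        rw [hb]
        simp only [Nat.reduceSub] at hε'
        have h0 : letterCrystal.φ 2 (fixedLetter a) = fixφ 2 a :=
          (fixedLetter_lengths 2 (by simp) a).1
        change 0 < letterCrystal.φ 3 x at h1
        change 0 < letterCrystal.φ 3 y at h2
        change 0 < letterCrystal.φ 2 z at h3
        exact chain_two_eq_some.2 ⟨(x, embedWord n l), (y, embedWord n l), (z, embedWord n l),
          tens_left (A := letterCrystal) hx (by omega),
          tens_left (A := letterCrystal) hy (by omega),
          tens_left (A := letterCrystal) hz (by omega),
          tens_left (A := letterCrystal) hw (by omega)⟩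
    · simp only [barF, if_neg hlt, Option.map_map]
      rw [show embedWord (n + 1) (a :: l) = (fixedLetter a, embedWord n l) from rfl,
        chain_tens_right hi hu (by omega), ih hl', Option.map_map]
      rfl

/-! ### Words made of constant blocks -/

theorem barε_replicate_append (i n : ℕ) (a : Fin 5) (l : List (Fin 5)) (h : fixφ i a + fixε i a ≤ 1) :
    barε i (List.replicate n a ++ l) = n * fixε i a + (barε i l - n * fixφ i a) := by
  induction n with
  | zero => simp
  | succ n ih =>
    rw [List.replicate_succ, List.cons_append, barε_cons, ih]
    rcases Nat.eq_zero_or_pos (fixφ i a) with h0 | h0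
    · rw [h0]
      ring_nf
      omega
    · have h1 : fixφ i a = 1 := by omega
      have h2 : fixε i a = 0 := by omega
      rw [h1, h2]
      omega

theorem barφ_replicate_append (i n : ℕ) (a : Fin 5) (l : List (Fin 5)) (h : fixφ i a + fixε i a ≤ 1) :
    barφ i (List.replicate n a ++ l) = barφ i l + (n * fixφ i a - barε i l) := by
  induction n with
  | zero => simp
  | succ n ih =>
    rw [List.replicate_succ, List.cons_append, barφ_cons, ih, barε_replicate_append _ _ _ _ h]
    rcases Nat.eq_zero_or_pos (fixφ i a) with h0 | h0
    · rw [h0]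
      omega
    · have h1 : fixφ i a = 1 := by omega
      have h2 : fixε i a = 0 := by omega
      rw [h1, h2]
      omega

theorem barF_replicate_append_zero {i : ℕ} (n : ℕ) {a : Fin 5} (l : List (Fin 5))
    (h : fixφ i a = 0) :
    barF i (List.replicate n a ++ l) = (barF i l).map (List.replicate n a ++ ·) := by
  induction n with
  | zero => simp
  | succ n ih =>
    rw [List.replicate_succ, List.cons_append, barF, if_neg (by omega), ih, Option.map_map]
    rfl

theorem barF_replicate_append_one {i : ℕ} (n : ℕ) {a b : Fin 5} (l : List (Fin 5))
    (h : fixφ i a = 1) (h' : fixε i a = 0) (hb : fixF i a = some b) :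
    barF i (List.replicate n a ++ l) = if barε i l < n then
      some (b :: (List.replicate (n - 1) a ++ l)) else (barF i l).map (List.replicate n a ++ ·) := by
  induction n with
  | zero => simp
  | succ n ih =>
    rw [List.replicate_succ, List.cons_append, barF, barε_replicate_append _ _ _ _ (by omega), ih, h,
      h', hb]
    by_cases h1 : barε i l < n + 1
    · rw [if_pos (by omega), if_pos h1]
      rfl
    · rw [if_neg (by omega), if_neg h1, if_neg (by omega), Option.map_map]
      rfl

/-- The words attached to worms. -/
def blockWord (n₁ n₂ n₃ n₄ n₅ n₆ n₇ : ℕ) : List (Fin 5) :=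
  List.replicate n₁ 4 ++ (List.replicate n₂ 3 ++ (List.replicate n₃ 1 ++ (List.replicate n₄ 0 ++
    (List.replicate n₅ 4 ++ (List.replicate n₆ 3 ++ (List.replicate n₇ 1 ++ []))))))

theorem replicate_append_cons (n : ℕ) (a : Fin 5) (l : List (Fin 5)) :
    List.replicate n a ++ a :: l = List.replicate (n + 1) a ++ l := by
  rw [List.replicate_succ', List.append_assoc]
  rfl

theorem barF_two_blockWord (n₁ n₂ n₃ n₄ n₅ n₆ n₇ : ℕ) :
    barF 2 (blockWord n₁ n₂ n₃ n₄ n₅ n₆ n₇) =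
      if n₆ < n₃ then some (blockWord n₁ (n₂ + 1) (n₃ - 1) n₄ n₅ n₆ n₇)
      else if 0 < n₇ then some (blockWord n₁ n₂ n₃ n₄ n₅ (n₆ + 1) (n₇ - 1)) else none := by
  have e : barε 2 (List.replicate n₄ 0 ++ (List.replicate n₅ 4 ++ (List.replicate n₆ 3 ++
      (List.replicate n₇ 1 ++ [])))) = n₆ := by
    simp (disch := decide) only [barε_replicate_append]
    simp [barε, barφε, fixφ, fixε]
  unfold blockWord
  rw [barF_replicate_append_zero (i := 2) n₁ (a := 4) _ rfl,
    barF_replicate_append_zero (i := 2) n₂ (a := 3) _ rfl,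
    barF_replicate_append_one (i := 2) n₃ (a := 1) (b := 3) _ rfl rfl rfl,
    barF_replicate_append_zero (i := 2) n₄ (a := 0) _ rfl,
    barF_replicate_append_zero (i := 2) n₅ (a := 4) _ rfl,
    barF_replicate_append_zero (i := 2) n₆ (a := 3) _ rfl,
    barF_replicate_append_one (i := 2) n₇ (a := 1) (b := 3) _ rfl rfl rfl, e]
  rw [show barε 2 [] = 0 from rfl, show barF 2 [] = none from rfl]
  split_ifs <;> simp only [Option.map_some, Option.map_none, replicate_append_cons]

theorem barF_one_blockWord (n₁ n₂ n₃ n₄ n₅ n₆ n₇ : ℕ) :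
    barF 1 (blockWord n₁ n₂ n₃ n₄ n₅ n₆ n₇) =
      if n₃ + (n₅ + (n₇ - n₆) - n₄) < n₂ then some (blockWord (n₁ + 1) (n₂ - 1) n₃ n₄ n₅ n₆ n₇)
      else if n₅ + (n₇ - n₆) < n₄ then some (blockWord n₁ n₂ (n₃ + 1) (n₄ - 1) n₅ n₆ n₇)
      else if n₇ < n₆ then some (blockWord n₁ n₂ n₃ n₄ (n₅ + 1) (n₆ - 1) n₇) else none := by
  have e7 : barε 1 (List.replicate n₇ 1 ++ []) = n₇ := by
    simp (disch := decide) only [barε_replicate_append]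
    simp [barε, barφε, fixφ, fixε]
  have e5 : barε 1 (List.replicate n₅ 4 ++ (List.replicate n₆ 3 ++
      (List.replicate n₇ 1 ++ []))) = n₅ + (n₇ - n₆) := by
    simp (disch := decide) only [barε_replicate_append]
    simp [barε, barφε, fixφ, fixε]
  have e3 : barε 1 (List.replicate n₃ 1 ++ (List.replicate n₄ 0 ++ (List.replicate n₅ 4 ++
      (List.replicate n₆ 3 ++ (List.replicate n₇ 1 ++ []))))) = n₃ + (n₅ + (n₇ - n₆) - n₄) := by
    simp (disch := decide) only [barε_replicate_append]
    simp [barε, barφε, fixφ, fixε]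
  unfold blockWord
  rw [barF_replicate_append_zero (i := 1) n₁ (a := 4) _ rfl,
    barF_replicate_append_one (i := 1) n₂ (a := 3) (b := 4) _ rfl rfl rfl,
    barF_replicate_append_zero (i := 1) n₃ (a := 1) _ rfl,
    barF_replicate_append_one (i := 1) n₄ (a := 0) (b := 1) _ rfl rfl rfl,
    barF_replicate_append_zero (i := 1) n₅ (a := 4) _ rfl,
    barF_replicate_append_one (i := 1) n₆ (a := 3) (b := 4) _ rfl rfl rfl,
    barF_replicate_append_zero (i := 1) n₇ (a := 1) _ rfl, e7, e5, e3]
  rw [show barF 1 [] = none from rfl]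
  split_ifs <;> simp only [Option.map_some, Option.map_none, replicate_append_cons]

/-! ### The word of a worm -/

/-- The word in the fixed letters attached to a six-tuple of the worm model. -/
def wormWord (g1 g2 : ℕ) : ℤ × ℤ × ℤ × ℤ × ℤ × ℤ → List (Fin 5)
  | (x', y, x'', y', x, y'') =>
    let r := max 0 (x + y'' - (g1 + g2))
    blockWord y'.toNat (x' / 2 + y - y').toNat (x - x' / 2 + y'' - y - r).toNat
      (g1 + g2 - x - y'' + r).toNat r.toNat (x'' / 2 - r).toNat (g1 - x'' / 2).toNat

theorem wormWord_length {g1 g2 : ℕ} {w : ℤ × ℤ × ℤ × ℤ × ℤ × ℤ} (hw : WormOK g1 g2 w) :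
    (wormWord g1 g2 w).length = 2 * g1 + g2 := by
  obtain ⟨x', y, x'', y', x, y''⟩ := w
  simp only [WormOK] at hw
  simp only [wormWord, blockWord, List.length_append, List.length_replicate, List.length_nil]
  omega

theorem barF_two_wormWord {g1 g2 : ℕ} {w : ℤ × ℤ × ℤ × ℤ × ℤ × ℤ} (hw : WormOK g1 g2 w) :
    barF 2 (wormWord g1 g2 w) =
      if WormOK g1 g2 (worm1 w) then some (wormWord g1 g2 (worm1 w)) else none := by
  obtain ⟨x', y, x'', y', x, y''⟩ := w
  obtain ⟨h₁, h₂, h₃, h₄, h₅, h₆, ⟨a, rfl⟩, ⟨b, rfl⟩, h₉, h₁₀, h₁₁, h₁₂⟩ := hw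
  generalize hv : worm1 (2 * a, y, 2 * b, y', x, y'') = v
  simp only [worm1] at hv
  simp only [wormWord, barF_two_blockWord]
  by_cases h : 2 * x > 2 * a + 2 * b
  · rw [if_pos h] at hv
    subst hv
    rw [if_pos (by omega), if_pos (by simp only [WormOK]; omega)]
    simp only
    congr 2 <;> omega
  · rw [if_neg h] at hv
    by_cases h' : x = 2 * a ∧ 2 * a = 2 * b ∧ y < y''
    · rw [if_pos h'] at hv
      subst hv
      rw [if_pos (by omega), if_pos (by simp only [WormOK]; omega)]
      simp only
      congr 2 <;> omega
    · rw [if_neg h'] at hv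
      subst hv
      rw [if_neg (by omega)]
      by_cases hb : b < g1
      · rw [if_pos (by omega), if_pos (by simp only [WormOK]; omega)]
        simp only
        congr 2 <;> omega
      · rw [if_neg (by omega), if_neg (by simp only [WormOK]; omega)]

theorem barF_one_wormWord {g1 g2 : ℕ} {w : ℤ × ℤ × ℤ × ℤ × ℤ × ℤ} (hw : WormOK g1 g2 w) :
    barF 1 (wormWord g1 g2 w) =
      if WormOK g1 g2 (worm2 w) then some (wormWord g1 g2 (worm2 w)) else none := by
  obtain ⟨x', y, x'', y', x, y''⟩ := w
  obtain ⟨h₁, h₂, h₃, h₄, h₅, h₆, ⟨a, rfl⟩, ⟨b, rfl⟩, h₉, h₁₀, h₁₁, h₁₂⟩ := hw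
  generalize hv : worm2 (2 * a, y, 2 * b, y', x, y'') = v
  simp only [worm2] at hv
  simp only [wormWord, barF_one_blockWord]
  by_cases h : 2 * y > y' + y''
  · rw [if_pos h] at hv
    subst hv
    rw [if_pos (by omega), if_pos (by simp only [WormOK]; omega)]
    simp only
    congr 2 <;> omega
  · rw [if_neg h] at hv
    rw [if_neg (by omega)]
    by_cases h' : y' = y ∧ y = y'' ∧ x < 2 * b
    · rw [if_pos h'] at hv
      subst hv
      rw [if_pos (c := WormOK g1 g2 _) (by simp only [WormOK]; omega)]
      by_cases hr : x + y'' < g1 + g2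
      · rw [if_pos (by omega)]
        simp only
        congr 2 <;> omega
      · rw [if_neg (by omega), if_pos (by omega)]
        simp only
        congr 2 <;> omega
    · rw [if_neg h'] at hv
      subst hv
      by_cases hb : y'' < g2
      · rw [if_pos (c := WormOK g1 g2 _) (by simp only [WormOK]; omega)]
        by_cases hr : x + y'' < g1 + g2
        · rw [if_pos (by omega)]
          simp only
          congr 2 <;> omega
        · rw [if_neg (by omega), if_pos (by omega)]
          simp only
          congr 2 <;> omega
      · rw [if_neg (by omega), if_neg (by omega),
          if_neg (c := WormOK g1 g2 _) (by simp only [WormOK]; omega)]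

theorem blockWord_injective {n₁ n₂ n₃ n₄ n₅ n₆ n₇ m₁ m₂ m₃ m₄ m₅ m₆ m₇ : ℕ}
    (h : blockWord n₁ n₂ n₃ n₄ n₅ n₆ n₇ = blockWord m₁ m₂ m₃ m₄ m₅ m₆ m₇)
    (hlen : n₁ + (n₂ + (n₃ + n₄)) = m₁ + (m₂ + (m₃ + m₄))) :
    n₁ = m₁ ∧ n₂ = m₂ ∧ n₃ = m₃ ∧ n₅ = m₅ ∧ n₆ = m₆ := by
  have split : ∀ n₁ n₂ n₃ n₄ n₅ n₆ n₇, blockWord n₁ n₂ n₃ n₄ n₅ n₆ n₇ =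
      (List.replicate n₁ 4 ++ (List.replicate n₂ 3 ++ (List.replicate n₃ 1 ++
        List.replicate n₄ 0))) ++ (List.replicate n₅ 4 ++ (List.replicate n₆ 3 ++
          List.replicate n₇ 1)) := by
    simp [blockWord]
  rw [split, split] at h
  obtain ⟨hl, hr⟩ := List.append_inj h (by simpa only [List.length_append, List.length_replicate])
  exact ⟨by simpa [List.count_replicate] using congrArg (List.count 4) hl,
    by simpa [List.count_replicate] using congrArg (List.count 3) hl,
    by simpa [List.count_replicate] using congrArg (List.count 1) hl,
    by simpa [List.count_replicate] using congrArg (List.count 4) hr,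
    by simpa [List.count_replicate] using congrArg (List.count 3) hr⟩

theorem worm_excess_bounds {g1 g2 : ℕ} {a b x y y' y'' r : ℤ} (h₁ : 0 ≤ a) (h₂ : b ≤ g1)
    (h₅ : y'' ≤ g2) (h₉ : y' ≤ y ∧ y ≤ y'') (h₁₀ : 2 * a ≤ x ∧ x ≤ 2 * b)
    (hr : r = max 0 (x + y'' - (g1 + g2))) :
    0 ≤ r ∧ r ≤ b ∧ r ≤ x - a + y'' - y ∧ 0 ≤ g1 + g2 - x - y'' + r := by
  omega

theorem worm_prefix_length {g1 g2 : ℕ} {a x y y' y'' r : ℤ} (h₁ : 0 ≤ y') (h₂ : 0 ≤ a + y - y')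
    (h₃ : r ≤ x - a + y'' - y) (h₄ : 0 ≤ g1 + g2 - x - y'' + r) :
    y'.toNat + ((a + y - y').toNat + ((x - a + y'' - y - r).toNat +
      (g1 + g2 - x - y'' + r).toNat)) = g1 + g2 := by
  omega

theorem worm_coordinates_unique {a b c x y y' y'' p q q'' : ℤ}
    (h₁ : a + y = c + q) (h₂ : x + y'' = p + q'') (i₁ : y' = y ∨ 2 * a = x)
    (i₂ : y = y'' ∨ x = 2 * b) (j₁ : y' = q ∨ 2 * c = p) (j₂ : q = q'' ∨ p = 2 * b)
    (h₃ : 2 * a ≤ x ∧ x ≤ 2 * b) (h₄ : y' ≤ y ∧ y ≤ y'') (h₅ : 2 * c ≤ p ∧ p ≤ 2 * b)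
    (h₆ : y' ≤ q ∧ q ≤ q'') : a = c ∧ y = q ∧ x = p ∧ y'' = q'' := by
  have h₇ : a = c := by
    rcases i₁ with i₁ | i₁ <;> rcases i₂ with i₂ | i₂ <;> rcases j₁ with j₁ | j₁ <;>
      rcases j₂ with j₂ | j₂ <;> omega
  have h₈ : x = p := by
    rcases i₁ with i₁ | i₁ <;> rcases i₂ with i₂ | i₂ <;> rcases j₁ with j₁ | j₁ <;>
      rcases j₂ with j₂ | j₂ <;> omega
  omega

theorem wormWord_injective {g1 g2 : ℕ} {v w : ℤ × ℤ × ℤ × ℤ × ℤ × ℤ} (hv : WormOK g1 g2 v)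
    (hw : WormOK g1 g2 w) (h : wormWord g1 g2 v = wormWord g1 g2 w) : v = w := by
  obtain ⟨x', y, x'', y', x, y''⟩ := v
  obtain ⟨h₁, h₂, h₃, h₄, h₅, h₆, ⟨a, rfl⟩, ⟨b, rfl⟩, h₉, h₁₀, h₁₁, h₁₂⟩ := hv
  obtain ⟨p', q, p'', q', p, q''⟩ := w
  obtain ⟨k₁, k₂, k₃, k₄, k₅, k₆, ⟨c, rfl⟩, ⟨d, rfl⟩, k₉, k₁₀, k₁₁, k₁₂⟩ := hw
  simp only [wormWord, Int.mul_ediv_cancel_left _ (two_ne_zero (α := ℤ))] at h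
  obtain ⟨r, hr⟩ : ∃ r, r = max 0 (x + y'' - (g1 + g2)) := ⟨_, rfl⟩
  obtain ⟨t, ht⟩ : ∃ t, t = max 0 (p + q'' - (g1 + g2)) := ⟨_, rfl⟩
  rw [← hr, ← ht] at h
  have i₁ : y' = y ∨ 2 * a = x := h₉.1.eq_or_lt.imp_right h₁₁
  have i₂ : y = y'' ∨ x = 2 * b := h₉.2.eq_or_lt.imp_right h₁₂
  have j₁ : q' = q ∨ 2 * c = p := k₉.1.eq_or_lt.imp_right k₁₁
  have j₂ : q = q'' ∨ p = 2 * d := k₉.2.eq_or_lt.imp_right k₁₂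
  clear h₁₁ h₁₂ k₁₁ k₁₂
  have s₁ := worm_excess_bounds (by linarith) (by linarith) h₅.2 h₉ h₁₀ hr
  have s₂ := worm_excess_bounds (by linarith) (by linarith) k₅.2 k₉ k₁₀ ht
  clear hr ht
  have inj : ∀ m n : ℤ, 0 ≤ m → 0 ≤ n → m.toNat = n.toNat → m = n := by omega
  obtain ⟨e1, e2, e3, e5, e6⟩ := blockWord_injective h (by
    rw [worm_prefix_length h₄.1 (by linarith) s₁.2.2.1 s₁.2.2.2,
      worm_prefix_length k₄.1 (by linarith) s₂.2.2.1 s₂.2.2.2])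
  obtain rfl := inj _ _ h₄.1 k₄.1 e1
  have f2 := inj _ _ (by linarith) (by linarith) e2
  have f3 := inj _ _ (by linarith) (by linarith) e3
  obtain rfl := inj _ _ s₁.1 s₂.1 e5
  have f6 := inj _ _ (by linarith) (by linarith) e6
  obtain rfl : b = d := by linarith
  obtain ⟨rfl, rfl, rfl, rfl⟩ := worm_coordinates_unique (by linarith) (by linarith) i₁ i₂ j₁ j₂
    h₁₀ h₉ k₁₀ k₉
  rfl

theorem exists_worm_pred {g1 g2 : ℕ} {w : ℤ × ℤ × ℤ × ℤ × ℤ × ℤ} (hw : WormOK g1 g2 w)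
    (h0 : w ≠ (0, 0, 0, 0, 0, 0)) : ∃ v, WormOK g1 g2 v ∧ (worm1 v = w ∨ worm2 v = w) := by
  obtain ⟨x', y, x'', y', x, y''⟩ := w
  obtain ⟨h₁, h₂, h₃, h₄, h₅, h₆, ⟨a, rfl⟩, ⟨b, rfl⟩, h₉, h₁₀, h₁₁, h₁₂⟩ := hw
  by_cases c1 : 0 < a ∧ y' = y ∧ a + b ≤ x
  · refine ⟨(2 * a - 2, y, 2 * b, y', x, y''), by simp only [WormOK]; omega, .inl ?_⟩
    simp only [worm1]
    rw [if_pos (by omega)]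
    simp
  by_cases c2 : y' < y ∧ x = 2 * b
  · refine ⟨(2 * a, y - 1, 2 * b, y', x, y''), by simp only [WormOK]; omega, .inl ?_⟩
    simp only [worm1]
    rw [if_neg (by omega), if_pos (by omega)]
    simp
  by_cases c3 : y = y'' ∧ x + 1 ≤ a + b ∧ x ≤ 2 * b - 2
  · refine ⟨(2 * a, y, 2 * b - 2, y', x, y''), by simp only [WormOK]; omega, .inl ?_⟩
    simp only [worm1]
    rw [if_neg (by omega), if_neg (by omega)]
    simp
  by_cases c4 : 0 < y' ∧ 2 * a = x ∧ y' + y'' ≤ 2 * y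
  · refine ⟨(2 * a, y, 2 * b, y' - 1, x, y''), by simp only [WormOK]; omega, .inr ?_⟩
    simp only [worm2]
    rw [if_pos (by omega)]
    simp
  by_cases c5 : y' = y ∧ y = y'' ∧ 2 * a < x
  · refine ⟨(2 * a, y, 2 * b, y', x - 1, y''), by simp only [WormOK]; omega, .inr ?_⟩
    simp only [worm2]
    rw [if_neg (by omega), if_pos (by omega)]
    simp
  by_cases c6 : 2 * y < y' + y'' ∧ y < y''
  · refine ⟨(2 * a, y, 2 * b, y', x, y'' - 1), by simp only [WormOK]; omega, .inr ?_⟩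
    simp only [worm2]
    rw [if_neg (by omega), if_neg (by omega)]
    simp
  refine absurd ?_ h0
  simp only [Prod.mk.injEq]
  omega

theorem wormOK_zero (g1 g2 : ℕ) : WormOK g1 g2 (0, 0, 0, 0, 0, 0) := by
  simp only [WormOK]
  omega

theorem wormWord_zero_lengths (g1 g2 : ℕ) :
    barφ 1 (wormWord g1 g2 (0, 0, 0, 0, 0, 0)) = g2 ∧
      barφ 2 (wormWord g1 g2 (0, 0, 0, 0, 0, 0)) = g1 ∧
      barε 1 (wormWord g1 g2 (0, 0, 0, 0, 0, 0)) = 0 ∧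
      barε 2 (wormWord g1 g2 (0, 0, 0, 0, 0, 0)) = 0 := by
  have h : wormWord g1 g2 (0, 0, 0, 0, 0, 0) =
      List.replicate (g1 + g2) 0 ++ (List.replicate g1 1 ++ []) := by
    simp [wormWord, blockWord]
    omega
  rw [h]
  simp (disch := decide) only [barε_replicate_append, barφ_replicate_append]
  simp [barε, barφ, barφε, fixφ, fixε]

/-- The sum of the coordinates of a worm. -/
def wormSum : ℤ × ℤ × ℤ × ℤ × ℤ × ℤ → ℤ
  | (x', y, x'', y', x, y'') => x' + y + x'' + y' + x + y''

theorem wormSum_nonneg {g1 g2 : ℕ} {w : ℤ × ℤ × ℤ × ℤ × ℤ × ℤ} (hw : WormOK g1 g2 w) :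
    0 ≤ wormSum w := by
  obtain ⟨x', y, x'', y', x, y''⟩ := w
  obtain ⟨h₁, h₂, h₃, h₄, h₅, h₆, -⟩ := hw
  simp only [wormSum]
  omega

theorem wormSum_lt_worm1 (w : ℤ × ℤ × ℤ × ℤ × ℤ × ℤ) : wormSum w < wormSum (worm1 w) := by
  obtain ⟨x', y, x'', y', x, y''⟩ := w
  simp only [worm1]
  split_ifs <;> simp only [wormSum] <;> omega

theorem wormSum_lt_worm2 (w : ℤ × ℤ × ℤ × ℤ × ℤ × ℤ) : wormSum w < wormSum (worm2 w) := by
  obtain ⟨x', y, x'', y', x, y''⟩ := w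
  simp only [worm2]
  split_ifs <;> simp only [wormSum] <;> omega

theorem wormGraph_F_one_iff {g1 g2 : ℕ} (v w : (WormGraph g1 g2).V) :
    (WormGraph g1 g2).F 1 v = some w ↔
      barF 2 (wormWord g1 g2 v.1) = some (wormWord g1 g2 w.1) := by
  rw [barF_two_wormWord v.2, show (WormGraph g1 g2).F 1 v =
    if h : WormOK g1 g2 (worm1 v.1) then some ⟨worm1 v.1, h⟩ else none from rfl]
  split_ifs with h
  · exact ⟨fun e => congrArg (fun z => some (wormWord g1 g2 z.1)) (Option.some.inj e),
      fun e => congrArg some (Subtype.ext (wormWord_injective h w.2 (Option.some.inj e)))⟩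
  · simp

theorem wormGraph_F_two_iff {g1 g2 : ℕ} (v w : (WormGraph g1 g2).V) :
    (WormGraph g1 g2).F 2 v = some w ↔
      barF 1 (wormWord g1 g2 v.1) = some (wormWord g1 g2 w.1) := by
  rw [barF_one_wormWord v.2, show (WormGraph g1 g2).F 2 v =
    if h : WormOK g1 g2 (worm2 v.1) then some ⟨worm2 v.1, h⟩ else none from rfl]
  split_ifs with h
  · exact ⟨fun e => congrArg (fun z => some (wormWord g1 g2 z.1)) (Option.some.inj e),
      fun e => congrArg some (Subtype.ext (wormWord_injective h w.2 (Option.some.inj e)))⟩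
  · simp

theorem exists_wormWord_of_barF {g1 g2 i : ℕ} (hi : i ∈ [1, 2])
    {w : ℤ × ℤ × ℤ × ℤ × ℤ × ℤ} (hw : WormOK g1 g2 w) {l : List (Fin 5)}
    (h : barF i (wormWord g1 g2 w) = some l) : ∃ v, WormOK g1 g2 v ∧ l = wormWord g1 g2 v := by
  simp only [List.mem_cons, List.not_mem_nil, or_false] at hi
  rcases hi with rfl | rfl
  · rw [barF_one_wormWord hw] at h
    split_ifs at h with hv
    exact ⟨_, hv, (Option.some.inj h).symm⟩
  · rw [barF_two_wormWord hw] at h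
    split_ifs at h with hv
    exact ⟨_, hv, (Option.some.inj h).symm⟩

theorem exists_barF_wormWord {g1 g2 : ℕ} {w : ℤ × ℤ × ℤ × ℤ × ℤ × ℤ} (hw : WormOK g1 g2 w)
    (h0 : w ≠ (0, 0, 0, 0, 0, 0)) : ∃ v, WormOK g1 g2 v ∧ wormSum v < wormSum w ∧
      ∃ i ∈ [1, 2], barF i (wormWord g1 g2 v) = some (wormWord g1 g2 w) := by
  obtain ⟨v, hv, rfl | rfl⟩ := exists_worm_pred hw h0
  · exact ⟨v, hv, wormSum_lt_worm1 v, 2, by simp, by rw [barF_two_wormWord hv, if_pos hw]⟩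
  · exact ⟨v, hv, wormSum_lt_worm2 v, 1, by simp, by rw [barF_one_wormWord hv, if_pos hw]⟩

/-! ### The crystal structure of a colored graph -/

section Iterate

variable {V : Type} {f : V → Option V}

theorem optIter_add (a b : ℕ) (v : V) :
    optIter f (a + b) v = (optIter f a v).bind (optIter f b) := by
  induction a generalizing v with
  | zero => simp [optIter]
  | succ a ih =>
    rw [Nat.succ_add, optIter, optIter, Option.bind_assoc]
    congr 1
    funext w
    exact ih w

theorem optIter_one (v : V) : optIter f 1 v = f v := by
  simp only [optIter]
  exact Option.bind_fun_some _

theorem optIter_lt_card [Finite V] (hac : ∀ v k, 0 < k → optIter f k v ≠ some v) {k : ℕ} {u v : V}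
    (h : optIter f k u = some v) : k < Nat.card V := by
  have hex : ∀ a : Fin (k + 1), ∃ x, optIter f a u = some x := by
    intro a
    have := optIter_add (f := f) a (k - a) u
    rw [Nat.add_sub_cancel' (by omega), h] at this
    obtain ⟨x, hx, -⟩ := Option.bind_eq_some_iff.1 this.symm
    exact ⟨x, hx⟩
  choose x hx using hex
  have hlt : ∀ a b : Fin (k + 1), a < b → x a ≠ x b := by
    intro a b hab he
    have h1 : (a : ℕ) < b := hab
    have := optIter_add (f := f) a (b - a) u
    rw [Nat.add_sub_cancel' h1.le, hx, hx, Option.bind_some, ← he] at this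
    exact hac _ _ (by omega) this.symm
  have hinj : Function.Injective x := by
    intro a b he
    rcases lt_trichotomy a b with hab | hab | hab
    · exact absurd he (hlt a b hab)
    · exact hab
    · exact absurd he.symm (hlt b a hab)
  have := Nat.card_le_card_of_injective x hinj
  simp only [Nat.card_eq_fintype_card, Fintype.card_fin] at this
  omega

end Iterate

theorem sSup_eq_add_one {S T : Set ℕ} (hS : BddAbove S) (h0 : 0 ∈ S)
    (h : ∀ k, k + 1 ∈ T ↔ k ∈ S) : sSup T = sSup S + 1 := by
  refine IsGreatest.csSup_eq ⟨(h _).2 (Nat.sSup_mem ⟨0, h0⟩ hS), ?_⟩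
  rintro (_ | k) hk
  · omega
  · exact Nat.succ_le_succ (le_csSup hS ((h k).1 hk))

theorem sSup_eq_zero {T : Set ℕ} (h : ∀ k, k + 1 ∉ T) : sSup T = 0 := by
  refine Nat.le_zero.1 (csSup_le' ?_)
  rintro (_ | k) hk
  · exact le_rfl
  · exact absurd hk (h k)

namespace PreGraph

variable {K : PreGraph} {C : Set ℕ}

theorem h_eq_add_one (hK : IsColored K C) {i : ℕ} {u v : K.V} (h : K.F i u = some v) :
    K.h i u = K.h i v + 1 := by
  obtain ⟨hfin, -, -, hac⟩ := hK
  refine sSup_eq_add_one ⟨Nat.card K.V, ?_⟩ (by simp [optIter]) ?_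
  · intro k hk
    obtain ⟨w, hw⟩ := Option.isSome_iff_exists.1 hk
    exact (optIter_lt_card (hac i) hw).le
  · intro k
    simp only [Set.mem_ofPred_eq, optIter, h, Option.bind_some]

theorem h_eq_zero {i : ℕ} {u : K.V} (h : K.F i u = none) : K.h i u = 0 :=
  sSup_eq_zero (by simp [optIter, h])

theorem t_eq_add_one (hK : IsColored K C) {i : ℕ} {u v : K.V} (h : K.F i u = some v) :
    K.t i v = K.t i u + 1 := by
  obtain ⟨hfin, -, hinj, hac⟩ := hK
  refine sSup_eq_add_one ⟨Nat.card K.V, ?_⟩ ⟨u, rfl⟩ ?_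
  · rintro k ⟨w, hw⟩
    exact (optIter_lt_card (hac i) hw).le
  · intro k
    simp only [Set.mem_ofPred_eq, optIter_add, Option.bind_eq_some_iff, optIter_one]
    constructor
    · rintro ⟨x, y, hx, hy⟩
      exact ⟨x, hinj i y u v hy h ▸ hx⟩
    · rintro ⟨x, hx⟩
      exact ⟨x, u, hx, h⟩

theorem t_eq_zero {i : ℕ} {v : K.V} (h : ∀ u, K.F i u ≠ some v) : K.t i v = 0 := by
  refine sSup_eq_zero ?_
  rintro k ⟨u, hu⟩
  rw [optIter_add, Option.bind_eq_some_iff] at hu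
  obtain ⟨y, -, hy⟩ := hu
  exact h y (by rwa [optIter_one] at hy)

theorem F_eq_some_iff (hK : IsColored K C) (i : ℕ) (u v : K.V) :
    K.F i u = some v ↔ K.Finv i v = some u := by
  unfold Finv
  constructor
  · intro h
    have hex : ∃ u, K.F i u = some v := ⟨u, h⟩
    rw [dif_pos hex, hK.2.2.1 i _ u v hex.choose_spec h]
  · intro h
    split_ifs at h with hex
    rw [← Option.some.inj h]
    exact hex.choose_spec

/-- A colored graph satisfying (A1), with its string lengths. -/
noncomputable def toCrystal (K : PreGraph) (hK : IsColored K C) : Crystal K.V where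
  f := K.F
  e := K.Finv
  φ := K.h
  ε := K.t
  f_iff_e := F_eq_some_iff hK
  φ_zero i u h := by
    cases hf : K.F i u with
    | none => rfl
    | some v => have := h_eq_add_one hK hf; omega
  ε_zero i u h := by
    cases hf : K.Finv i u with
    | none => rfl
    | some v => have := t_eq_add_one hK ((F_eq_some_iff hK _ _ _).2 hf); omega
  f_of_pos i u h := by
    cases hf : K.F i u with
    | none => have := h_eq_zero hf; omega
    | some v => exact ⟨v, rfl⟩
  e_of_pos i u h := by
    by_contra hne
    push Not at hne
    have := t_eq_zero (i := i) (v := u) fun v hv => hne v ((F_eq_some_iff hK _ _ _).1 hv)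
    omega
  φ_step _ _ _ h := h_eq_add_one hK h
  ε_step _ _ _ h := t_eq_add_one hK h

theorem labels_of_A2at {i j : ℕ} (hij : Neighb i j) (h2 : A2at K i j) {u v : K.V}
    (h : K.F i u = some v) :
    (K.h j v = K.h j u + 1 ∧ K.t j v = K.t j u) ∨ (K.h j v = K.h j u ∧ K.t j u = K.t j v + 1) := by
  obtain ⟨e1, e2, e3⟩ := h2.1 u v h
  rw [if_pos hij] at e3
  omega

theorem toCrystal_half (hK : IsColored K C) {i j : ℕ} (hij : Neighb i j) (h2 : A2at K i j)
    (h2' : A2at K j i) (h3 : A3at K i j) (h4 : A4at K i j) :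
    (K.toCrystal hK).Half i j ∧ (K.toCrystal hK).dual.Half i j := by
  have wt : ∀ u v, K.F i u = some v → _ := fun _ _ => labels_of_A2at hij h2
  have wt' : ∀ u v, K.F j u = some v → _ := fun _ _ => labels_of_A2at hij.symm h2'
  constructor
  · refine ⟨wt, ?_, ?_, ?_⟩
    · intro u v w huv hvw hl
      have e1 := h2.2 u v w huv hvw
      have e2 := wt v w hvw
      simp only [toCrystal] at hl ⊢
      omega
    · intro u v v' huv huv' hl
      obtain ⟨e, hw⟩ := h3.1 u v v' huv huv' hl
      refine ⟨?_, hw⟩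
      simp only [toCrystal]
      omega
    · intro u v v' huv huv' hl hl'
      simp only [toCrystal] at huv huv' hl hl'
      obtain ⟨w, e, e'⟩ := h4.1 u v v' huv huv' (by omega) (by omega)
      simp only [Option.bind_eq_some_iff, huv, huv', Option.some.injEq] at e e'
      obtain ⟨b, ⟨a, ⟨_, rfl, ha⟩, hb⟩, hw⟩ := e
      obtain ⟨d, ⟨c, ⟨_, rfl, hc⟩, hd⟩, hw'⟩ := e'
      exact ⟨a, b, c, d, w, ha, hb, hw, hc, hd, hw'⟩
  · have inv := F_eq_some_iff hK
    refine ⟨?_, ?_, ?_, ?_⟩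
    · intro u v h
      have := wt v u ((inv _ _ _).2 h)
      simp only [toCrystal, Crystal.dual]
      omega
    · intro u v w huv hvw hl
      have huv' := (inv _ _ _).2 huv
      have hvw' := (inv _ _ _).2 hvw
      have e1 := h2.2 w v u hvw' huv'
      have e2 := wt w v hvw'
      have e3 := wt v u huv'
      simp only [toCrystal, Crystal.dual] at hl ⊢
      omega
    · intro u v v' huv huv' hl
      have kuv := (inv _ _ _).2 huv
      have kuv' := (inv _ _ _).2 huv'
      simp only [toCrystal, Crystal.dual] at hl ⊢
      have e2 := wt v u kuv
      obtain ⟨e, w, hw, hw'⟩ := h3.2 v v' u kuv kuv' (by omega)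
      refine ⟨?_, w, (inv _ _ _).1 hw, (inv _ _ _).1 hw'⟩
      have e3 := wt' v' u kuv'
      omega
    · intro u v v' huv huv' hl hl'
      have kuv := (inv _ _ _).2 huv
      have kuv' := (inv _ _ _).2 huv'
      simp only [toCrystal, Crystal.dual] at huv huv' hl hl'
      have e2 := wt v u kuv
      have e3 := wt' v' u kuv'
      obtain ⟨w, e, e'⟩ := h4.2 v v' u kuv kuv' (by omega) (by omega)
      simp only [Option.bind_eq_some_iff, huv, huv', Option.some.injEq] at e e'
      obtain ⟨b, ⟨a, ⟨_, rfl, ha⟩, hb⟩, hw⟩ := e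
      obtain ⟨d, ⟨c, ⟨_, rfl, hc⟩, hd⟩, hw'⟩ := e'
      exact ⟨a, b, c, d, w, ha, hb, hw, hc, hd, hw'⟩

theorem toCrystal_farPair (hK : IsColored K C) {i j : ℕ} (hij : Far i j) (h2 : A2at K i j)
    (h5 : A5at K i j) : (K.toCrystal hK).FarPair i j where
  wt u v h := by
    obtain ⟨e1, e2, e3⟩ := h2.1 u v h
    rw [if_neg (by unfold Neighb; unfold Far at hij; omega)] at e3
    simp only [toCrystal]
    omega
  sq u v v' h h' := by
    simp only [toCrystal] at h h' ⊢
    simpa [h, h'] using h5 (K.F i) (.inl rfl) (K.F j) (.inl rfl) u (by simp [h]) (by simp [h'])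
  dual_sq u v v' h h' := by
    simp only [toCrystal, F_eq_some_iff hK] at h h' ⊢
    simpa [h, h'] using h5 (K.Finv i) (.inr rfl) (K.Finv j) (.inr rfl) v (by simp [h])
      (by simp [h'])

theorem toCrystal_isRegular (hK : IsACrystal 4 K) : (K.toCrystal hK.1).IsRegular where
  color i u v h := by
    by_contra hi
    have := hK.1.2.1 i hi u
    simp only [toCrystal] at h
    simp [this] at h
  near i j h1 h2 h3 h4 hij := by
    have a2 := hK.2.2.1
    have a34 := hK.2.2.2.1
    have hne : i ≠ j := by unfold Neighb at hij; omega
    have k := toCrystal_half hK.1 hij (a2 i ⟨h1, h2⟩ j ⟨h3, h4⟩ hne) (a2 j ⟨h3, h4⟩ i ⟨h1, h2⟩ hne.symm)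
      (a34 i ⟨h1, h2⟩ j ⟨h3, h4⟩ hij).1 (a34 i ⟨h1, h2⟩ j ⟨h3, h4⟩ hij).2
    have k' := toCrystal_half hK.1 hij.symm (a2 j ⟨h3, h4⟩ i ⟨h1, h2⟩ hne.symm)
      (a2 i ⟨h1, h2⟩ j ⟨h3, h4⟩ hne) (a34 j ⟨h3, h4⟩ i ⟨h1, h2⟩ hij.symm).1
      (a34 j ⟨h3, h4⟩ i ⟨h1, h2⟩ hij.symm).2
    exact ⟨k.1, k'.1, k.2, k'.2⟩
  far i j h1 h2 h3 h4 hij :=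
    toCrystal_farPair hK.1 hij
      (hK.2.2.1 i ⟨h1, h2⟩ j ⟨h3, h4⟩ (by unfold Far at hij; omega))
      (hK.2.2.2.2 i ⟨h1, h2⟩ j ⟨h3, h4⟩ hij)

theorem toCrystal_reach (hK : IsACrystal 4 K) {s : K.V} (hs : IsSource K s) (u : K.V) :
    ∃ n, (K.toCrystal hK.1).Reach s n u := by
  have hu := hK.2.1 s u
  induction hu with
  | refl => exact ⟨0, .zero⟩
  | tail _ hst ih =>
    obtain ⟨n, hn⟩ := ih
    obtain ⟨i, h | h⟩ := hst
    · exact ⟨n + 1, hn.succ h⟩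
    · obtain ⟨m, -, hm⟩ := hn.pred (toCrystal_isRegular hK) (fun i => t_eq_zero (hs i)) h
      exact ⟨m, hm⟩

theorem source_unique (hK : IsACrystal 4 K) {s s' : K.V} (hs : IsSource K s) (hs' : IsSource K s') :
    s' = s := by
  obtain ⟨n, hn⟩ := toCrystal_reach hK hs s'
  cases hn with
  | zero => rfl
  | succ _ h => exact absurd h (hs' _ _)

end PreGraph

namespace Crystal

variable {V W : Type} {A : Crystal V} {B : Crystal W} {π : V → W}

theorem map_bind_of_comm {o : Option V} {p : V → Option V} {q : W → Option W}
    (h : ∀ u, (p u).map π = q (π u)) : (o.bind p).map π = (o.map π).bind q := by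
  cases o <;> simp [h]

theorem map_chain (hπ : ∀ i u, (A.f i u).map π = B.f i (π u)) (i : ℕ) (u : V) :
    (A.chain i u).map π = B.chain i (π u) := by
  unfold chain
  split_ifs
  · rw [map_bind_of_comm (hπ 4), hπ]
  · rw [map_bind_of_comm (hπ 2), map_bind_of_comm (hπ 3), map_bind_of_comm (hπ 3), hπ]
  · rfl

theorem exists_chain_preimage
    (hπ : ∀ i u y, B.f i y = some (π u) → ∃ v, π v = y ∧ A.f i v = some u) {i : ℕ} {u : V} {y : W}
    (hi : i ∈ [1, 2]) (h : B.chain i y = some (π u)) : ∃ v, π v = y ∧ A.chain i v = some u := by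
  simp only [List.mem_cons, List.not_mem_nil, or_false] at hi
  rcases hi with rfl | rfl
  · obtain ⟨x, h1, h2⟩ := chain_one_eq_some.1 h
    obtain ⟨a, rfl, ha⟩ := hπ _ _ _ h2
    obtain ⟨b, rfl, hb⟩ := hπ _ _ _ h1
    exact ⟨b, rfl, chain_one_eq_some.2 ⟨a, hb, ha⟩⟩
  · obtain ⟨x, y, z, h1, h2, h3, h4⟩ := chain_two_eq_some.1 h
    obtain ⟨a, rfl, ha⟩ := hπ _ _ _ h4
    obtain ⟨b, rfl, hb⟩ := hπ _ _ _ h3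
    obtain ⟨c, rfl, hc⟩ := hπ _ _ _ h2
    obtain ⟨d, rfl, hd⟩ := hπ _ _ _ h1
    exact ⟨d, rfl, chain_two_eq_some.2 ⟨c, b, a, hd, hc, hb, ha⟩⟩

theorem Reach.chain_pred (hA : A.IsRegular) {s : V} (hs : ∀ i, A.ε i s = 0) {n i : ℕ} {u v : V}
    (hi : i ∈ [1, 2]) (hu : Reach A s n u) (h : A.chain i v = some u) :
    ∃ m < n, Reach A s m v := by
  simp only [List.mem_cons, List.not_mem_nil, or_false] at hi
  rcases hi with rfl | rfl
  · obtain ⟨x, h1, h2⟩ := chain_one_eq_some.1 h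
    obtain ⟨m, rfl, hx⟩ := hu.pred hA hs h2
    obtain ⟨k, rfl, hv⟩ := hx.pred hA hs h1
    exact ⟨k, by omega, hv⟩
  · obtain ⟨x, y, z, h1, h2, h3, h4⟩ := chain_two_eq_some.1 h
    obtain ⟨m, rfl, hz⟩ := hu.pred hA hs h4
    obtain ⟨k, rfl, hy⟩ := hz.pred hA hs h3
    obtain ⟨p, rfl, hx⟩ := hy.pred hA hs h2
    obtain ⟨q, rfl, hv⟩ := hx.pred hA hs h1
    exact ⟨q, by omega, hv⟩

theorem Reach.map_reversal {s : V} {σ : V → V} {τ : W → W}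
    (hπ : ∀ i u, (A.f i u).map π = B.f i (π u))
    (hσ : ∀ i u v, A.f i u = some v → A.f (5 - i) (σ u) = some (σ v)) (hτ : B.Reverses τ)
    (hs : π (σ s) = τ (π s)) {n : ℕ} {u : V} (hu : Reach A s n u) : π (σ u) = τ (π u) := by
  induction hu with
  | zero => exact hs
  | @succ n i u v _ h ih =>
    have h1 := hπ (5 - i) (σ u)
    rw [hσ i u v h, ih, hτ.f_eq, ← hπ, h] at h1
    exact Option.some.inj h1

theorem IsRegular.ε_eq_zero (hB : B.IsRegular) {u : W} (h : ∀ i, 1 ≤ i → i ≤ 4 → B.ε i u = 0)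
    (i : ℕ) : B.ε i u = 0 := by
  by_contra hne
  obtain ⟨v, hv⟩ := B.e_of_pos i u (Nat.pos_of_ne_zero hne)
  have hi := hB.color i v u ((B.f_iff_e i v u).2 hv)
  exact hne (h i hi.1 hi.2)

end Crystal

open Crystal

section Words

variable {V : Type} {A : Crystal V} {g1 g2 : ℕ} {π : V → Crystal.Pow Letter (2 * g1 + g2)} {s : V}

theorem exists_image_eq_wormWord
    (hs : π s = embedWord (2 * g1 + g2) (wormWord g1 g2 (0, 0, 0, 0, 0, 0)))
    (hπ : ∀ i u, (A.f i u).map π = (letterCrystal.pow (2 * g1 + g2)).f i (π u))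
    (w : ℤ × ℤ × ℤ × ℤ × ℤ × ℤ) (hw : WormOK g1 g2 w) :
    ∃ u, π u = embedWord (2 * g1 + g2) (wormWord g1 g2 w) := by
  induction hn : (wormSum w).toNat using Nat.strong_induction_on generalizing w with
  | _ n ih =>
    by_cases h0 : w = (0, 0, 0, 0, 0, 0)
    · exact ⟨s, h0 ▸ hs⟩
    obtain ⟨v, hv, hlt, i, hi, hvw⟩ := exists_barF_wormWord hw h0
    have := wormSum_nonneg hv
    obtain ⟨u, hu⟩ := ih _ (by omega) v hv rfl
    have hc := chain_embedWord hi (wormWord_length hv)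
    rw [hvw, ← hu, ← map_chain hπ, Option.map_some, Option.map_eq_some_iff] at hc
    obtain ⟨x, -, hx⟩ := hc
    exact ⟨x, hx⟩

theorem exists_wormWord_eq_image (hA : A.IsRegular) (hε : ∀ i, A.ε i s = 0)
    (hs : π s = embedWord (2 * g1 + g2) (wormWord g1 g2 (0, 0, 0, 0, 0, 0)))
    (hπε : ∀ i u, 1 ≤ i → i ≤ 4 → A.ε i u = (letterCrystal.pow (2 * g1 + g2)).ε i (π u))
    (hpull : ∀ i u y, (letterCrystal.pow (2 * g1 + g2)).f i y = some (π u) →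
      ∃ v, π v = y ∧ A.f i v = some u)
    {n : ℕ} {u : V} (hu : A.Reach s n u) (hfix : powRev (2 * g1 + g2) (π u) = π u) :
    ∃ w, WormOK g1 g2 w ∧ π u = embedWord (2 * g1 + g2) (wormWord g1 g2 w) := by
  induction n using Nat.strong_induction_on generalizing u with
  | _ n ih =>
    cases hu with
    | zero => exact ⟨_, wormOK_zero g1 g2, hs⟩
    | @succ m i x _ hx hxu =>
      have hi := hA.color _ _ _ hxu
      have hpos : 0 < A.ε i u := by rw [A.ε_step _ _ _ hxu]; omega
      rw [hπε i u hi.1 hi.2] at hpos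
      obtain ⟨j, hj, hjpos⟩ : ∃ j ∈ [1, 2], 0 < (letterCrystal.pow (2 * g1 + g2)).ε j (π u) := by
        have h1 := (pow_reverses (2 * g1 + g2)).ε_fixed hfix (i := 1) (by omega) (by omega)
        have h2 := (pow_reverses (2 * g1 + g2)).ε_fixed hfix (i := 2) (by omega) (by omega)
        obtain ⟨hi1, hi4⟩ := hi
        interval_cases i
        · exact ⟨1, by simp, hpos⟩
        · exact ⟨2, by simp, hpos⟩
        · exact ⟨2, by simp, h2 ▸ hpos⟩
        · exact ⟨1, by simp, h1 ▸ hpos⟩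
      obtain ⟨l, hl, hul⟩ := exists_embedWord hfix
      rw [hul, (embedWord_lengths hj hl).2] at hjpos
      obtain ⟨l', hl'⟩ := exists_barF_of_barε_pos hj hjpos
      have hlen : l'.length = 2 * g1 + g2 := by rw [← hl, barF_length hl']
      have hc := chain_embedWord hj hlen
      rw [hl', Option.map_some, ← hul] at hc
      obtain ⟨v, hv, hvu⟩ := exists_chain_preimage hpull hj hc
      obtain ⟨k, hk, hkv⟩ := (Reach.succ hx hxu).chain_pred hA hε hj hvu
      obtain ⟨w, hw, hvw⟩ := ih k hk hkv (by rw [hv, powRev_embedWord])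
      have hll : l' = wormWord g1 g2 w :=
        embedWord_injective hlen (wormWord_length hw) (hv.symm.trans hvw)
      rw [hll] at hl'
      obtain ⟨z, hz, rfl⟩ := exists_wormWord_of_barF hj hw hl'
      exact ⟨z, hz, hul⟩

end Words

namespace PreGraph

theorem chainC_eq_chain {K : PreGraph} {C : Set ℕ} (hK : IsColored K C) (i : ℕ) (u : K.V) :
    chainC K 2 i u = (K.toCrystal hK).chain i u := by
  unfold chainC Crystal.chain
  split_ifs with h1 h2 h3 h4 h5 <;> first | omega | rfl | (subst h4; rfl)

end PreGraph

theorem extractC_F_eq_some {K : PreGraph} {σ : K.V → K.V} {n i : ℕ}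
    (u v : (extractC K n σ).V) :
    (extractC K n σ).F i u = some v ↔ chainC K n i u.1 = some v.1 := by
  rw [show (extractC K n σ).F i u = (chainC K n i u.1).pbind
    fun w _ => if hw : σ w = w then some ⟨w, hw⟩ else none from rfl]
  cases h : chainC K n i u.1 with
  | none => simp
  | some w =>
    rw [Option.pbind_some]
    split_ifs with hw
    · exact ⟨fun e => congrArg (fun z => some z.1) (Option.some.inj e),
        fun e => congrArg some (Subtype.ext (Option.some.inj e))⟩
    · constructor
      · simp
      · intro e
        exact absurd (by rw [Option.some.inj e]; exact v.2) hw

theorem chain_embedWord_wormWord_iff {g1 g2 i : ℕ} (hi : i ∈ [1, 2])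
    {v w : ℤ × ℤ × ℤ × ℤ × ℤ × ℤ} (hv : WormOK g1 g2 v) (hw : WormOK g1 g2 w) :
    (letterCrystal.pow (2 * g1 + g2)).chain i (embedWord (2 * g1 + g2) (wormWord g1 g2 v)) =
      some (embedWord (2 * g1 + g2) (wormWord g1 g2 w)) ↔
    barF i (wormWord g1 g2 v) = some (wormWord g1 g2 w) := by
  rw [chain_embedWord hi (wormWord_length hv), Option.map_eq_some_iff]
  constructor
  · rintro ⟨l, hl, he⟩
    have hlen : l.length = 2 * g1 + g2 := by rw [barF_length hl, wormWord_length hv]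
    rw [hl, embedWord_injective hlen (wormWord_length hw) he]
  · exact fun h => ⟨_, h, rfl⟩

theorem source_fixed {K : PreGraph} (hK : IsACrystal 4 K) {s : K.V} (hs : IsSource K s)
    {σ : K.V → K.V} (hσb : Function.Bijective σ)
    (hσ : ∀ (i : ℕ) (u v : K.V), K.F i u = some v ↔ K.F (5 - i) (σ u) = some (σ v)) :
    σ s = s := by
  refine PreGraph.source_unique hK hs fun i u h => ?_
  have hi := (PreGraph.toCrystal_isRegular hK).color i u (σ s) h
  obtain ⟨x, rfl⟩ := hσb.2 u
  have e : 5 - (5 - i) = i := by omega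
  exact hs (5 - i) x ((hσ (5 - i) x s).2 (by rwa [e]))

theorem pow_zero_worm_lengths (g1 g2 : ℕ) {i : ℕ} (h1 : 1 ≤ i) (h4 : i ≤ 4) :
    (letterCrystal.pow (2 * g1 + g2)).ε i
        (embedWord (2 * g1 + g2) (wormWord g1 g2 (0, 0, 0, 0, 0, 0))) = 0 ∧
      (letterCrystal.pow (2 * g1 + g2)).φ i
        (embedWord (2 * g1 + g2) (wormWord g1 g2 (0, 0, 0, 0, 0, 0))) =
        if i = 1 ∨ i = 4 then g2 else g1 := by
  have hl := wormWord_length (wormOK_zero g1 g2)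
  have hR := pow_reverses (2 * g1 + g2)
  have hfix := powRev_embedWord (2 * g1 + g2) (wormWord g1 g2 (0, 0, 0, 0, 0, 0))
  obtain ⟨p1, p2, e1, e2⟩ := wormWord_zero_lengths g1 g2
  have l1 := embedWord_lengths (i := 1) (by simp) hl
  have l2 := embedWord_lengths (i := 2) (by simp) hl
  rw [p1, e1] at l1
  rw [p2, e2] at l2
  have r1 := hR.ε_fixed hfix (i := 1) (by omega) (by omega)
  have r2 := hR.ε_fixed hfix (i := 2) (by omega) (by omega)
  have q1 := hR.φ_fixed hfix (i := 1) (by omega) (by omega)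
  have q2 := hR.φ_fixed hfix (i := 2) (by omega) (by omega)
  interval_cases i
  · exact ⟨l1.2, l1.1⟩
  · exact ⟨l2.2, l2.1⟩
  · exact ⟨r2.trans l2.2, q2.trans l2.1⟩
  · exact ⟨r1.trans l1.2, q1.trans l1.1⟩

/-- the symmetric extract of a symmetric `A_4`-crystal `K(c1, c2, c2, c1)`
is isomorphic, as a 2-colored graph with `1bar ↦ 2tilde` and `2bar ↦ 1tilde`, to the worm
graph `W(c2, c1)`. -/
theorem A4_extract_iso_worm
    (K : PreGraph) (hK : IsACrystal 4 K)
    (s : K.V) (hs : IsSource K s)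
    (c : ℕ → ℕ) (hc : ∀ i, 1 ≤ i → i ≤ 4 → K.h i s = c i)
    (hsym1 : c 4 = c 1) (hsym2 : c 3 = c 2)
    (σ : K.V → K.V) (hσb : Function.Bijective σ)
    (hσ : ∀ (i : ℕ) (u v : K.V), K.F i u = some v ↔ K.F (5 - i) (σ u) = some (σ v)) :
    IsoVia (extractC K 2 σ) (WormGraph (c 2) (c 1))
      (fun x => if x = 1 then 2 else if x = 2 then 1 else 0) := by
  have hA := PreGraph.toCrystal_isRegular hK
  have hB : (letterCrystal.pow (2 * c 2 + c 1)).IsRegular := letterCrystal_isRegular.pow _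
  have hreach := PreGraph.toCrystal_reach hK hs
  have hε : ∀ i, (K.toCrystal hK.1).ε i s = 0 := fun i => PreGraph.t_eq_zero (hs i)
  obtain ⟨π, hinj, hπs, hmap, hpull, hπε⟩ := exists_embedding hA hB hε
    (hB.ε_eq_zero fun i h1 h4 => (pow_zero_worm_lengths (c 2) (c 1) h1 h4).1)
    (fun i h1 h4 => by
      rw [(pow_zero_worm_lengths (c 2) (c 1) h1 h4).2]
      refine (hc i h1 h4).trans ?_
      interval_cases i <;> simp [hsym1, hsym2])
    hreach
  have hrev : ∀ u, π (σ u) = powRev (2 * c 2 + c 1) (π u) := by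
    intro u
    obtain ⟨n, hn⟩ := hreach u
    refine hn.map_reversal hmap (fun i u v h => (hσ i u v).1 h) (pow_reverses _) ?_
    rw [source_fixed hK hs hσb hσ, hπs, powRev_embedWord]
  have hfix : ∀ u, σ u = u ↔ powRev (2 * c 2 + c 1) (π u) = π u := fun u => by
    rw [← hrev, hinj.eq_iff]
  have hex : ∀ u : (extractC K 2 σ).V, ∃ w : (WormGraph (c 2) (c 1)).V,
      π u.1 = embedWord (2 * c 2 + c 1) (wormWord (c 2) (c 1) w.1) := by
    intro u
    obtain ⟨n, hn⟩ := hreach u.1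
    obtain ⟨w, hw, h⟩ := exists_wormWord_eq_image hA hε hπs hπε hpull hn ((hfix u.1).1 u.2)
    exact ⟨⟨w, hw⟩, h⟩
  choose e he using hex
  have hbij : Function.Bijective e := by
    constructor
    · intro u v huv
      refine Subtype.ext (hinj ?_)
      rw [he u, he v, huv]
    · intro w
      obtain ⟨u, hu⟩ := exists_image_eq_wormWord hπs hmap w.1 w.2
      refine ⟨⟨u, (hfix u).2 (by rw [hu, powRev_embedWord])⟩, Subtype.ext ?_⟩
      refine wormWord_injective (e _).2 w.2
        (embedWord_injective (wormWord_length (e _).2) (wormWord_length w.2) ?_)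
      exact (he _).symm.trans hu
  refine ⟨Equiv.ofBijective e hbij, fun i u v => ?_⟩
  have key : (extractC K 2 σ).F i u = some v ↔
      (letterCrystal.pow (2 * c 2 + c 1)).chain i (π u.1) = some (π v.1) := by
    rw [extractC_F_eq_some, PreGraph.chainC_eq_chain hK.1, ← map_chain hmap,
      ← Option.map_some, (Option.map_injective hinj).eq_iff]
  rw [key, he u, he v, Equiv.ofBijective_apply, Equiv.ofBijective_apply]
  by_cases h1 : i = 1
  · subst h1
    exact (chain_embedWord_wormWord_iff (by simp) (e u).2 (e v).2).trans
      (wormGraph_F_two_iff (e u) (e v)).symm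
  by_cases h2 : i = 2
  · subst h2
    exact (chain_embedWord_wormWord_iff (by simp) (e u).2 (e v).2).trans
      (wormGraph_F_one_iff (e u) (e v)).symm
  simp [chain, WormGraph, h1, h2]
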